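/- The Lagrangian density of the 3-graph K_4^3 ∪ e (the disjoint union of the complete 3-uniform graph on 4 vertices and a single edge) equals √3/3, i.e. π_λ(K_4^3 ∪ e) = √3/3. -/

import Mathlib

open Finset

/-- An `r`-uniform hypergraph (r-graph) with vertices drawn from `ℕ`. -/
structure HyperGraph (r : ℕ) where
  verts : Finset ℕ
  edges : Finset (Finset ℕ)
  edges_sub : ∀ e ∈ edges, e ⊆ verts
  card_eq : ∀ e ∈ edges, e.card = r

/-- A 3-uniform hypergraph (3-graph). -/
abbrev ThreeGraph := HyperGraph 3

/-- A feasible weight vector on `G`: nonnegative weights on the vertices summing to 1. -/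
def HyperGraph.IsFeasible {r : ℕ} (G : HyperGraph r) (w : ℕ → ℝ) : Prop :=
  (∀ v ∈ G.verts, 0 ≤ w v) ∧ ∑ v ∈ G.verts, w v = 1

/-- The Lagrangian function `λ(G, w) = Σ_{e ∈ E(G)} Π_{v ∈ e} w v`. -/
noncomputable def HyperGraph.lagFun {r : ℕ} (G : HyperGraph r) (w : ℕ → ℝ) : ℝ :=
  ∑ e ∈ G.edges, ∏ v ∈ e, w v

/-- The Lagrangian `λ(G)`: the maximum of `λ(G, w)` over feasible weight vectors. -/
noncomputable def HyperGraph.lag {r : ℕ} (G : HyperGraph r) : ℝ :=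
  sSup {x : ℝ | ∃ w, G.IsFeasible w ∧ G.lagFun w = x}

/-- `G` contains a copy of `F`: an injection of the vertices of `F` into those of `G`
mapping every edge of `F` to an edge of `G`. -/
def HyperGraph.ContainsCopy {r : ℕ} (G F : HyperGraph r) : Prop :=
  ∃ f : ℕ → ℕ, Set.InjOn f ↑F.verts ∧ (∀ v ∈ F.verts, f v ∈ G.verts) ∧
    ∀ e ∈ F.edges, e.image f ∈ G.edges

/-- `G` is `F`-free. -/
def HyperGraph.Free {r : ℕ} (G F : HyperGraph r) : Prop := ¬ G.ContainsCopy F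

/-- `H` is a subgraph of `G`. -/
def HyperGraph.IsSubgraph {r : ℕ} (H G : HyperGraph r) : Prop :=
  H.verts ⊆ G.verts ∧ H.edges ⊆ G.edges

/-- `G` is dense: every proper subgraph has strictly smaller Lagrangian. -/
def HyperGraph.LagDense {r : ℕ} (G : HyperGraph r) : Prop :=
  ∀ H : HyperGraph r, H.IsSubgraph G → (H.verts ≠ G.verts ∨ H.edges ≠ G.edges) →
    H.lag < G.lag

/-- The Lagrangian density `π_λ(F) = sup { r! · λ(G) : G is F-free }`. -/
noncomputable def lagDensity {r : ℕ} (F : HyperGraph r) : ℝ :=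
  sSup {x : ℝ | ∃ G : HyperGraph r, G.Free F ∧ x = (Nat.factorial r : ℝ) * G.lag}

/-- An optimum weight vector for `G`. -/
def HyperGraph.IsOptimal {r : ℕ} (G : HyperGraph r) (w : ℕ → ℝ) : Prop :=
  G.IsFeasible w ∧ G.lagFun w = G.lag

/-- `K_4^3 ∪ e`: the disjoint union of the complete 3-graph on `{1,2,3,4}`
and the single edge `{5,6,7}`. -/
def K43e : ThreeGraph where
  verts := {1, 2, 3, 4, 5, 6, 7}
  edges := {{1, 2, 3}, {1, 2, 4}, {1, 3, 4}, {2, 3, 4}, {5, 6, 7}}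
  edges_sub := by decide
  card_eq := by decide



/-! ### Part A -/

/-- symmetric feature attached to a non-edge root -/
def featA (e p q r : Bool) : ℤ :=
  bif e then 0 else
    match p.toNat + q.toNat + r.toNat with
    | 0 => 10
    | 1 => 5
    | 2 => 1
    | _ => -10

/-- second symmetric feature attached to a non-edge root -/
def featB (e p q r : Bool) : ℤ :=
  bif e then 0 else
    match p.toNat + q.toNat + r.toNat with
    | 0 => 0
    | 1 => 5
    | 2 => -5
    | _ => 4

/-- antisymmetric feature attached to an edge root -/
def featC (e p q r : Bool) : ℤ :=
  bif e then
    match p.toNat + q.toNat + r.toNat with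
    | 1 => 4 * ((p.toNat : ℤ) - (q.toNat : ℤ))
    | 2 => 3 * ((p.toNat : ℤ) - (q.toNat : ℤ))
    | _ => 0
  else 0

/-- the combined quadratic expression -/
def flagQ (e p q r pp qq rr : Bool) : ℤ :=
  1728 * (featA e p q r * featA e pp qq rr) + 5436 * (featB e p q r * featB e pp qq rr)
    + 5740 * (featC e p q r * featC e pp qq rr + featC e p r q * featC e pp rr qq
      + featC e q r p * featC e qq rr pp)

theorem flag_pointwise : ∀ (b012 b013 b014 b023 b024 b034 b123 b124 b134 b234 : Bool),
    (b012 && b013 && b023 && b123) = false → (b012 && b014 && b024 && b124) = false →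
    (b013 && b014 && b034 && b134) = false → (b023 && b024 && b034 && b234) = false →
    (b123 && b124 && b134 && b234) = false →
    300000 * ((b012.toNat + b013.toNat + b014.toNat + b023.toNat + b024.toNat + b034.toNat
      + b123.toNat + b124.toNat + b134.toNat + b234.toNat : ℕ) : ℤ)
    + (flagQ b012 b013 b023 b123 b014 b024 b124
      + flagQ b013 b012 b023 b123 b014 b034 b134
      + flagQ b014 b012 b024 b124 b013 b034 b134
      + flagQ b023 b012 b013 b123 b024 b034 b234
      + flagQ b024 b012 b014 b124 b023 b034 b234
      + flagQ b034 b013 b014 b134 b023 b024 b234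
      + flagQ b123 b012 b013 b023 b124 b134 b234
      + flagQ b124 b012 b014 b024 b123 b134 b234
      + flagQ b134 b013 b014 b034 b123 b124 b234
      + flagQ b234 b023 b024 b034 b123 b124 b134) ≤ 1731000 := by
  decide +kernel


section partA
variable {V : Type*} [Fintype V]

/-- five-tuples as functions -/
def tup5 (V : Type*) : (Fin 5 → V) ≃ V × V × V × V × V where
  toFun s := (s 0, s 1, s 2, s 3, s 4)
  invFun t := ![t.1, t.2.1, t.2.2.1, t.2.2.2.1, t.2.2.2.2]
  left_inv s := by ext i; fin_cases i <;> rfl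
  right_inv t := rfl

/-- weighted sum over five-tuples -/
noncomputable def W5 (x : V → ℝ) (g : (Fin 5 → V) → ℝ) : ℝ :=
  ∑ s : Fin 5 → V, (∏ i, x (s i)) * g s

theorem W5_perm (x : V → ℝ) (g : (Fin 5 → V) → ℝ) (f : Fin 5 → Fin 5) (hf : Function.Bijective f) :
    W5 x (fun s => g (fun i => s (f i))) = W5 x g := by
  unfold W5
  let p : Equiv.Perm (Fin 5) := Equiv.ofBijective f hf
  rw [← Equiv.sum_comp (Equiv.arrowCongr p.symm (Equiv.refl V))
    (fun s => (∏ i, x (s i)) * g s)]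
  refine Finset.sum_congr rfl fun s _ => ?_
  have h1 : ∀ i, (Equiv.arrowCongr p.symm (Equiv.refl V)) s i = s (f i) := fun i => rfl
  have h2 : (Equiv.arrowCongr p.symm (Equiv.refl V)) s = fun i => s (f i) := funext h1
  simp only [h2]
  congr 1
  exact (Equiv.prod_comp p (fun i => x (s i))).symm

theorem W5_nested (x : V → ℝ) (g : (Fin 5 → V) → ℝ) :
    W5 x g = ∑ a, ∑ b, ∑ c, ∑ u, ∑ v, x a * x b * x c * x u * x v * g ![a, b, c, u, v] := by
  unfold W5
  rw [← Equiv.sum_comp (tup5 V).symm]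
  simp only [Fintype.sum_prod_type]
  refine Finset.sum_congr rfl fun a _ => Finset.sum_congr rfl fun b _ =>
    Finset.sum_congr rfl fun c _ => Finset.sum_congr rfl fun u _ =>
    Finset.sum_congr rfl fun v _ => ?_
  change (∏ i, x (![a, b, c, u, v] i)) * g ![a, b, c, u, v] = _
  rw [Fin.prod_univ_five]
  rfl

theorem W5_sq (x : V → ℝ) (hx : ∀ v, 0 ≤ x v) (h : V → V → V → V → ℝ) :
    0 ≤ W5 x (fun s => h (s 0) (s 1) (s 2) (s 3) * h (s 0) (s 1) (s 2) (s 4)) := by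
  rw [W5_nested]
  refine Finset.sum_nonneg fun a _ => Finset.sum_nonneg fun b _ => Finset.sum_nonneg fun c _ => ?_
  have : ∑ u, ∑ v, x a * x b * x c * x u * x v * (h a b c u * h a b c v)
      = x a * x b * x c * (∑ u, x u * h a b c u) ^ 2 := by
    rw [sq, Finset.sum_mul_sum, Finset.mul_sum]
    refine Finset.sum_congr rfl fun u _ => ?_
    rw [Finset.mul_sum]
    exact Finset.sum_congr rfl fun v _ => by ring
  have h2 : 0 ≤ x a * x b * x c * (∑ u, x u * h a b c u) ^ 2 := by
    have := hx a; have := hx b; have := hx c; positivity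
  calc (0:ℝ) ≤ _ := h2
    _ = _ := this.symm

theorem W5_add (x : V → ℝ) (g h : (Fin 5 → V) → ℝ) :
    W5 x (fun s => g s + h s) = W5 x g + W5 x h := by
  unfold W5; rw [← Finset.sum_add_distrib]; exact Finset.sum_congr rfl fun s _ => by ring

theorem W5_smul (x : V → ℝ) (k : ℝ) (h : (Fin 5 → V) → ℝ) :
    W5 x (fun s => k * h s) = k * W5 x h := by
  unfold W5; rw [Finset.mul_sum]; exact Finset.sum_congr rfl fun s _ => by ring

theorem W5_mono (x : V → ℝ) (hx : ∀ v, 0 ≤ x v) (g h : (Fin 5 → V) → ℝ) (H : ∀ s, g s ≤ h s) :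
    W5 x g ≤ W5 x h := by
  unfold W5
  exact Finset.sum_le_sum fun s _ =>
    mul_le_mul_of_nonneg_left (H s) (Finset.prod_nonneg fun i _ => hx _)

theorem W5_const (x : V → ℝ) (h1 : ∑ v, x v = 1) (k : ℝ) : W5 x (fun _ => k) = k := by
  rw [W5_nested]
  simp only [← Finset.sum_mul, ← Finset.mul_sum, h1, mul_one, one_mul]

theorem W5_triple (x : V → ℝ) (h1 : ∑ v, x v = 1) (h : V → V → V → ℝ) :
    W5 x (fun s => h (s 0) (s 1) (s 2)) = ∑ a, ∑ b, ∑ c, x a * x b * x c * h a b c := by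
  rw [W5_nested]
  refine Finset.sum_congr rfl fun a _ => Finset.sum_congr rfl fun b _ =>
    Finset.sum_congr rfl fun c _ => ?_
  have : ∀ u v, x a * x b * x c * x u * x v * h a b c = (x a * x b * x c * h a b c) * (x u * x v) :=
    fun u v => by ring
  simp only [Matrix.cons_val, this, ← Finset.mul_sum, h1, mul_one]

/-- the flag quadratic at a five-tuple -/
def flagV (e : V → V → V → Bool) (a b c u v : V) : ℤ :=
  flagQ (e a b c) (e a b u) (e a c u) (e b c u) (e a b v) (e a c v) (e b c v)

theorem flagV_nonneg (e : V → V → V → Bool) (x : V → ℝ) (hx : ∀ v, 0 ≤ x v) :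
    0 ≤ W5 x (fun s => (flagV e (s 0) (s 1) (s 2) (s 3) (s 4) : ℝ)) := by
  have hA := W5_sq x hx (fun a b c u => (featA (e a b c) (e a b u) (e a c u) (e b c u) : ℝ))
  have hB := W5_sq x hx (fun a b c u => (featB (e a b c) (e a b u) (e a c u) (e b c u) : ℝ))
  have hC := W5_sq x hx (fun a b c u => (featC (e a b c) (e a b u) (e a c u) (e b c u) : ℝ))
  have hD := W5_sq x hx (fun a b c u => (featC (e a b c) (e a b u) (e b c u) (e a c u) : ℝ))
  have hE := W5_sq x hx (fun a b c u => (featC (e a b c) (e a c u) (e b c u) (e a b u) : ℝ))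
  simp only [flagV, flagQ]
  push_cast
  simp only [W5_add, W5_smul]
  linarith

theorem k4free_bound (e : V → V → V → Bool) (x : V → ℝ) (hx : ∀ v, 0 ≤ x v) (h1 : ∑ v, x v = 1)
    (s1 : ∀ a b c, e a b c = e b a c) (s2 : ∀ a b c, e a b c = e a c b)
    (hK : ∀ a b c d, ¬ (e a b c = true ∧ e a b d = true ∧ e a c d = true ∧ e b c d = true)) :
    ∑ a, ∑ b, ∑ c, x a * x b * x c * (if e a b c = true then (1:ℝ) else 0) ≤ 577 / 1000 := by
  set T := ∑ a, ∑ b, ∑ c, x a * x b * x c * (if e a b c = true then (1:ℝ) else 0) with hT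
  let I : V → V → V → ℝ := fun a b c => ((e a b c).toNat : ℝ)
  have hI : ∀ a b c, (if e a b c = true then (1:ℝ) else 0) = I a b c := by
    intro a b c; simp only [I]; cases e a b c <;> simp
  have hT0 : W5 x (fun s => I (s 0) (s 1) (s 2)) = T := by
    rw [W5_triple x h1, hT]; simp only [hI]
  let Q : V → V → V → V → V → ℝ := fun a b c u v => (flagV e a b c u v : ℝ)
  have hQ0 : 0 ≤ W5 x (fun s => Q (s 0) (s 1) (s 2) (s 3) (s 4)) := flagV_nonneg e x hx
  set q := W5 x (fun s => Q (s 0) (s 1) (s 2) (s 3) (s 4)) with hq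
  have pQ : ∀ f : Fin 5 → Fin 5, Function.Bijective f →
      W5 x (fun s => Q (s (f 0)) (s (f 1)) (s (f 2)) (s (f 3)) (s (f 4))) = q := fun f hf =>
    W5_perm x (fun s => Q (s 0) (s 1) (s 2) (s 3) (s 4)) f hf
  have pI : ∀ f : Fin 5 → Fin 5, Function.Bijective f →
      W5 x (fun s => I (s (f 0)) (s (f 1)) (s (f 2))) = T := fun f hf =>
    (W5_perm x (fun s => I (s 0) (s 1) (s 2)) f hf).trans hT0
  have key : W5 x (fun s => 300000 * (I (s 0) (s 1) (s 2) + I (s 0) (s 1) (s 3) + I (s 0) (s 1) (s 4)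
      + I (s 0) (s 2) (s 3) + I (s 0) (s 2) (s 4) + I (s 0) (s 3) (s 4) + I (s 1) (s 2) (s 3)
      + I (s 1) (s 2) (s 4) + I (s 1) (s 3) (s 4) + I (s 2) (s 3) (s 4))
      + (Q (s 0) (s 1) (s 2) (s 3) (s 4) + Q (s 0) (s 1) (s 3) (s 2) (s 4)
      + Q (s 0) (s 1) (s 4) (s 2) (s 3) + Q (s 0) (s 2) (s 3) (s 1) (s 4)
      + Q (s 0) (s 2) (s 4) (s 1) (s 3) + Q (s 0) (s 3) (s 4) (s 1) (s 2)
      + Q (s 1) (s 2) (s 3) (s 0) (s 4) + Q (s 1) (s 2) (s 4) (s 0) (s 3)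
      + Q (s 1) (s 3) (s 4) (s 0) (s 2) + Q (s 2) (s 3) (s 4) (s 0) (s 1)))
      ≤ W5 x (fun _ => (1731000 : ℝ)) := by
    refine W5_mono x hx _ _ fun s => ?_
    have hk : ∀ a b c d, (e a b c && e a b d && e a c d && e b c d) = false := by
      intro a b c d
      have := hK a b c d
      revert this
      cases e a b c <;> cases e a b d <;> cases e a c d <;> cases e b c d <;> simp
    have := flag_pointwise (e (s 0) (s 1) (s 2)) (e (s 0) (s 1) (s 3)) (e (s 0) (s 1) (s 4))
      (e (s 0) (s 2) (s 3)) (e (s 0) (s 2) (s 4)) (e (s 0) (s 3) (s 4)) (e (s 1) (s 2) (s 3))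
      (e (s 1) (s 2) (s 4)) (e (s 1) (s 3) (s 4)) (e (s 2) (s 3) (s 4))
      (hk _ _ _ _) (hk _ _ _ _) (hk _ _ _ _) (hk _ _ _ _) (hk _ _ _ _)
    -- rotations needed to normalise the arguments
    have r1 : ∀ a b c, e a b c = e b c a := fun a b c => by rw [s1 a b c, s2 b a c]
    have r : ∀ a b c, e b c a = e a b c := fun a b c => (r1 a b c).symm
    simp only [Q, I, flagV]
    simp only [s2 (s 0) (s 3) (s 2), s2 (s 1) (s 3) (s 2), s2 (s 0) (s 4) (s 2),
      s2 (s 1) (s 4) (s 2), s2 (s 0) (s 4) (s 3), s2 (s 1) (s 4) (s 3),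
      s2 (s 0) (s 2) (s 1), s2 (s 0) (s 3) (s 1), s2 (s 0) (s 4) (s 1),
      s2 (s 2) (s 4) (s 3),
      r (s 1) (s 2) (s 3), r (s 1) (s 2) (s 4), r (s 1) (s 3) (s 4), r (s 2) (s 3) (s 4),
      r (s 0) (s 1) (s 2), r (s 0) (s 1) (s 3), r (s 0) (s 1) (s 4), r (s 0) (s 2) (s 3),
      r (s 0) (s 2) (s 4), r (s 0) (s 3) (s 4)]
    exact_mod_cast this
  rw [W5_const x h1] at key
  simp only [W5_add, W5_smul] at key
  have i1 := pI ![0,1,2,3,4] (by decide)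
  have i2 := pI ![0,1,3,2,4] (by decide)
  have i3 := pI ![0,1,4,2,3] (by decide)
  have i4 := pI ![0,2,3,1,4] (by decide)
  have i5 := pI ![0,2,4,1,3] (by decide)
  have i6 := pI ![0,3,4,1,2] (by decide)
  have i7 := pI ![1,2,3,0,4] (by decide)
  have i8 := pI ![1,2,4,0,3] (by decide)
  have i9 := pI ![1,3,4,0,2] (by decide)
  have i10 := pI ![2,3,4,0,1] (by decide)
  have q1 := pQ ![0,1,2,3,4] (by decide)
  have q2 := pQ ![0,1,3,2,4] (by decide)
  have q3 := pQ ![0,1,4,2,3] (by decide)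
  have q4 := pQ ![0,2,3,1,4] (by decide)
  have q5 := pQ ![0,2,4,1,3] (by decide)
  have q6 := pQ ![0,3,4,1,2] (by decide)
  have q7 := pQ ![1,2,3,0,4] (by decide)
  have q8 := pQ ![1,2,4,0,3] (by decide)
  have q9 := pQ ![1,3,4,0,2] (by decide)
  have q10 := pQ ![2,3,4,0,1] (by decide)
  simp only [Matrix.cons_val] at i1 i2 i3 i4 i5 i6 i7 i8 i9 i10 q1 q2 q3 q4 q5 q6 q7 q8 q9 q10
  rw [i1, i2, i3, i4, i5, i6, i7, i8, i9, i10, q1, q2, q3, q4, q5, q6, q7, q8, q9, q10] at key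
  linarith

end partA

theorem cII3h (u z r : ℝ) (hu : 0 ≤ u) (hz : 0 ≤ z) (hr : 0 ≤ r) :
    6*(u^3/27+z*u^2/3)+3*r*(u^2/3+2*z*u)+3*r^2*u ≤ (577/1000) * (u+z+r)^3 := by
  linarith only [mul_nonneg hu (sq_nonneg ((-8/25)*u + (1)*z + (13/100)*r)),
    mul_nonneg hu (sq_nonneg ((1)*u + (-21/25)*r)),
    mul_nonneg hz (sq_nonneg ((1)*u + (-7/100)*z + (-83/100)*r)),
    mul_nonneg hz (sq_nonneg ((1)*z + (-7/50)*r)),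
    mul_nonneg hz (sq_nonneg ((1)*r)),
    mul_nonneg hr (sq_nonneg ((-11/20)*u + (1)*z + (8/25)*r)),
    mul_nonneg hr (sq_nonneg ((1)*u + (-17/20)*r)),
    mul_nonneg (mul_nonneg hu hu) hu,
    mul_nonneg (mul_nonneg hu hu) hz,
    mul_nonneg (mul_nonneg hu hu) hr,
    mul_nonneg (mul_nonneg hu hz) hz,
    mul_nonneg (mul_nonneg hu hz) hr,
    mul_nonneg (mul_nonneg hu hr) hr,
    mul_nonneg (mul_nonneg hz hz) hz,
    mul_nonneg (mul_nonneg hz hz) hr,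
    mul_nonneg (mul_nonneg hz hr) hr,
    mul_nonneg (mul_nonneg hr hr) hr]

theorem cII2h (u z r : ℝ) (hu : 0 ≤ u) (hz : 0 ≤ z) (hr : 0 ≤ r) :
    6*(u^2*z/4+u*z^2/4)+3*r*(u^2/4+2*u*z+z^2/2)+3*r^2*u ≤ (577/1000) * (u+z+r)^3 := by
  linarith only [mul_nonneg hu (sq_nonneg ((1)*u + (-33/50)*z + (-51/100)*r)),
    mul_nonneg hu (sq_nonneg ((1)*z + (-69/100)*r)),
    mul_nonneg hu (sq_nonneg ((1)*r)),
    mul_nonneg hz (sq_nonneg ((-41/50)*u + (-27/100)*z + (1)*r)),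
    mul_nonneg hz (sq_nonneg ((-18/25)*u + (1)*z)),
    mul_nonneg hz (sq_nonneg ((1)*u)),
    mul_nonneg hr (sq_nonneg ((1)*u + (-14/25)*z + (-59/100)*r)),
    mul_nonneg hr (sq_nonneg ((1)*z + (-73/100)*r)),
    mul_nonneg (mul_nonneg hu hu) hu,
    mul_nonneg (mul_nonneg hu hu) hz,
    mul_nonneg (mul_nonneg hu hu) hr,
    mul_nonneg (mul_nonneg hu hz) hz,
    mul_nonneg (mul_nonneg hu hz) hr,
    mul_nonneg (mul_nonneg hu hr) hr,
    mul_nonneg (mul_nonneg hz hz) hz,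
    mul_nonneg (mul_nonneg hz hz) hr,
    mul_nonneg (mul_nonneg hz hr) hr,
    mul_nonneg (mul_nonneg hr hr) hr]

theorem cII1h (u z r : ℝ) (hu : 0 ≤ u) (hz : 0 ≤ z) (hr : 0 ≤ r) :
    6*(u*z^2/3+z^3/27)+6*r*(u*z+z^2/3)+3*r^2*u ≤ (577/1000) * (u+z+r)^3 := by
  linarith only [mul_nonneg hu (sq_nonneg ((1)*u + (-1/5)*z + (-23/50)*r)),
    mul_nonneg hu (sq_nonneg ((-14/25)*z + (1)*r)),
    mul_nonneg hu (sq_nonneg ((1)*z)),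
    mul_nonneg hz (sq_nonneg ((1)*u + (-4/25)*z + (-27/50)*r)),
    mul_nonneg hz (sq_nonneg ((-57/100)*z + (1)*r)),
    mul_nonneg hr (sq_nonneg ((1)*u + (-21/100)*z + (-9/20)*r)),
    mul_nonneg hr (sq_nonneg ((-29/50)*z + (1)*r)),
    mul_nonneg (mul_nonneg hu hu) hu,
    mul_nonneg (mul_nonneg hu hu) hz,
    mul_nonneg (mul_nonneg hu hu) hr,
    mul_nonneg (mul_nonneg hu hz) hz,
    mul_nonneg (mul_nonneg hu hz) hr,
    mul_nonneg (mul_nonneg hu hr) hr,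
    mul_nonneg (mul_nonneg hz hz) hz,
    mul_nonneg (mul_nonneg hz hz) hr,
    mul_nonneg (mul_nonneg hz hr) hr,
    mul_nonneg (mul_nonneg hr hr) hr]

theorem mode4h (y h r : ℝ) (hy : 0 ≤ y) (hh : 0 ≤ h) (hr : 0 ≤ r) :
    y*(2*h+r)*(y+(2*h+r))-y*h^2+h^3/2+3/5*r*h^2-r^3/2 ≤ (577/6000) * (2*y+2*h+r)^3 := by
  linarith only [mul_nonneg hy (sq_nonneg ((1)*y + (-21/50)*h + (-3/5)*r)),
    mul_nonneg hy (sq_nonneg ((-41/100)*h + (1)*r)),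
    mul_nonneg hy (sq_nonneg ((1)*h)),
    mul_nonneg hh (sq_nonneg ((1)*y + (-49/100)*h + (-9/20)*r)),
    mul_nonneg hh (sq_nonneg ((-43/100)*h + (1)*r)),
    mul_nonneg hr (sq_nonneg ((1)*y + (-12/25)*h + (-12/25)*r)),
    mul_nonneg hr (sq_nonneg ((-11/25)*h + (1)*r)),
    mul_nonneg (mul_nonneg hy hy) hy,
    mul_nonneg (mul_nonneg hy hy) hh,
    mul_nonneg (mul_nonneg hy hy) hr,
    mul_nonneg (mul_nonneg hy hh) hh,
    mul_nonneg (mul_nonneg hy hh) hr,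
    mul_nonneg (mul_nonneg hy hr) hr,
    mul_nonneg (mul_nonneg hh hh) hh,
    mul_nonneg (mul_nonneg hh hh) hr,
    mul_nonneg (mul_nonneg hh hr) hr,
    mul_nonneg (mul_nonneg hr hr) hr]

theorem mode3h (m d h r : ℝ) (hm : 0 ≤ m) (hd : 0 ≤ d) (hh : 0 ≤ h) (hr : 0 ≤ r) :
    m*(m+d)*(2*h+r)+(m+d/2)*(2*h+r)^2-(m+d/2)*h^2+h^3/2+r*h^2-2/5*m*h^2-m^2*r+m^3/2 ≤ (577/6000) * (2*m+d+2*h+r)^3 := by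
  linarith only [mul_nonneg hm (sq_nonneg ((7/25)*m + (1)*d + (-3/20)*h + (-37/100)*r)),
    mul_nonneg hm (sq_nonneg ((1)*m + (-3/5)*h + (7/100)*r)),
    mul_nonneg hm (sq_nonneg ((-22/25)*h + (1)*r)),
    mul_nonneg hd (sq_nonneg ((1)*m + (9/100)*d + (-17/50)*h + (-13/50)*r)),
    mul_nonneg hd (sq_nonneg ((1)*d + (-1/50)*h + (-33/100)*r)),
    mul_nonneg hd (sq_nonneg ((-22/25)*h + (1)*r)),
    mul_nonneg hd (sq_nonneg ((1)*h)),
    mul_nonneg hh (sq_nonneg ((81/100)*m + (1)*d + (-2/5)*h + (-2/5)*r)),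
    mul_nonneg hh (sq_nonneg ((-29/100)*m + (-71/100)*h + (1)*r)),
    mul_nonneg hh (sq_nonneg ((1)*m + (-27/50)*h)),
    mul_nonneg hh (sq_nonneg ((1)*h)),
    mul_nonneg hr (sq_nonneg ((1)*m + (19/50)*d + (-9/20)*h + (-6/25)*r)),
    mul_nonneg hr (sq_nonneg ((1)*d + (-2/25)*h + (-27/100)*r)),
    mul_nonneg hr (sq_nonneg ((1)*h + (-99/100)*r)),
    mul_nonneg (mul_nonneg hm hm) hm,
    mul_nonneg (mul_nonneg hm hm) hd,
    mul_nonneg (mul_nonneg hm hm) hh,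
    mul_nonneg (mul_nonneg hm hm) hr,
    mul_nonneg (mul_nonneg hm hd) hd,
    mul_nonneg (mul_nonneg hm hd) hh,
    mul_nonneg (mul_nonneg hm hd) hr,
    mul_nonneg (mul_nonneg hm hh) hh,
    mul_nonneg (mul_nonneg hm hh) hr,
    mul_nonneg (mul_nonneg hm hr) hr,
    mul_nonneg (mul_nonneg hd hd) hd,
    mul_nonneg (mul_nonneg hd hd) hh,
    mul_nonneg (mul_nonneg hd hd) hr,
    mul_nonneg (mul_nonneg hd hh) hh,
    mul_nonneg (mul_nonneg hd hh) hr,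
    mul_nonneg (mul_nonneg hd hr) hr,
    mul_nonneg (mul_nonneg hh hh) hh,
    mul_nonneg (mul_nonneg hh hh) hr,
    mul_nonneg (mul_nonneg hh hr) hr,
    mul_nonneg (mul_nonneg hr hr) hr]



theorem cII4 (a r : ℝ) (hr : 0 ≤ r) (h : a + r = 1) :
    6*a^3/16 + 9*r*a^2/8 + 3*r^2*a ≤ 577/1000 := by
  have : r = 1 - a := by linarith
  subst this
  nlinarith [sq_nonneg (a - 4/9), mul_nonneg hr (sq_nonneg (a - 4/9))]

theorem e2_three (a b c : ℝ) : a*b+a*c+b*c ≤ (a+b+c)^2/3 := by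
  nlinarith [sq_nonneg (a-b), sq_nonneg (a-c), sq_nonneg (b-c)]

theorem e3_three (a b c : ℝ) (ha : 0 ≤ a) (hb : 0 ≤ b) (hc : 0 ≤ c) :
    a*b*c ≤ (a+b+c)^3/27 := by
  nlinarith [mul_nonneg ha (sq_nonneg (b-c)), mul_nonneg hb (sq_nonneg (a-c)),
    mul_nonneg hc (sq_nonneg (a-b)), mul_nonneg (add_nonneg (add_nonneg ha hb) hc)
      (add_nonneg (add_nonneg (sq_nonneg (a-b)) (sq_nonneg (a-c))) (sq_nonneg (b-c)))]

theorem q4 (a b c d r : ℝ) (ha : 0 ≤ a) (hb : 0 ≤ b) (hc : 0 ≤ c) (hd : 0 ≤ d) (hr : 0 ≤ r)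
    (h : a+b+c+d+r = 1) :
    6*(a*b*c+a*b*d+a*c*d+b*c*d) + 3*r*(a*b+a*c+a*d+b*c+b*d+c*d) + 3*r^2*(a+b+c+d)
      ≤ 577/1000 := by
  have h0 := cII4 (a+b+c+d) r hr h
  have h2 : a*b+a*c+a*d+b*c+b*d+c*d ≤ 3*(a+b+c+d)^2/8 := by
    nlinarith [sq_nonneg (a-b), sq_nonneg (a-c), sq_nonneg (b-c), sq_nonneg (a-d),
      sq_nonneg (b-d), sq_nonneg (c-d)]
  have h3 : a*b*c+a*b*d+a*c*d+b*c*d ≤ (a+b+c+d)^3/16 := by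
    nlinarith [mul_nonneg (add_nonneg ha hb) (sq_nonneg (c-d)),
      mul_nonneg (add_nonneg hc hd) (sq_nonneg (a-b)),
      mul_nonneg (add_nonneg (add_nonneg ha hb) (add_nonneg hc hd)) (sq_nonneg (a+b-c-d))]
  nlinarith [mul_le_mul_of_nonneg_left h2 hr]

theorem q3 (a b c d r : ℝ) (ha : 0 ≤ a) (hb : 0 ≤ b) (hc : 0 ≤ c) (hd : 0 ≤ d) (hr : 0 ≤ r)
    (h : a+b+c+d+r = 1) :
    6*(a*b*c+a*b*d+a*c*d+b*c*d) + 3*r*(a*b+a*c+2*(a*d)+b*c+2*(b*d)+2*(c*d)) + 3*r^2*(a+b+c)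
      ≤ 577/1000 := by
  have h0 := cII3h (a+b+c) d r (by positivity) hd hr
  rw [h, one_pow, mul_one] at h0
  have h2 := e2_three a b c
  have h3 := e3_three a b c ha hb hc
  nlinarith [mul_le_mul_of_nonneg_left h2 hr, mul_le_mul_of_nonneg_left h2 hd]

theorem q2 (a b c d r : ℝ) (ha : 0 ≤ a) (hb : 0 ≤ b) (hc : 0 ≤ c) (hd : 0 ≤ d) (hr : 0 ≤ r)
    (h : a+b+c+d+r = 1) :
    6*(a*b*c+a*b*d+a*c*d+b*c*d) + 3*r*(a*b+2*(a*c)+2*(a*d)+2*(b*c)+2*(b*d)+2*(c*d)) + 3*r^2*(a+b)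
      ≤ 577/1000 := by
  have h0 := cII2h (a+b) (c+d) r (by positivity) (by positivity) hr
  rw [show a+b+(c+d)+r = 1 by linarith, one_pow, mul_one] at h0
  have h2 : a*b ≤ (a+b)^2/4 := by nlinarith [sq_nonneg (a-b)]
  have h3 : c*d ≤ (c+d)^2/4 := by nlinarith [sq_nonneg (c-d)]
  nlinarith [mul_le_mul_of_nonneg_left h2 hr, mul_le_mul_of_nonneg_left h3 hr,
    mul_le_mul_of_nonneg_left h2 (add_nonneg hc hd), mul_le_mul_of_nonneg_left h3 (add_nonneg ha hb)]

theorem q1 (a b c d r : ℝ) (ha : 0 ≤ a) (hb : 0 ≤ b) (hc : 0 ≤ c) (hd : 0 ≤ d) (hr : 0 ≤ r)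
    (h : a+b+c+d+r = 1) :
    6*(a*b*c+a*b*d+a*c*d+b*c*d) + 3*r*(2*(a*b)+2*(a*c)+2*(a*d)+2*(b*c)+2*(b*d)+2*(c*d)) + 3*r^2*a
      ≤ 577/1000 := by
  have h0 := cII1h a (b+c+d) r ha (by positivity) hr
  rw [show a+(b+c+d)+r = 1 by linarith, one_pow, mul_one] at h0
  have h2 := e2_three b c d
  have h3 := e3_three b c d hb hc hd
  nlinarith [mul_le_mul_of_nonneg_left h2 hr, mul_le_mul_of_nonneg_left h2 ha]

theorem qII (a b c d r s1 s2 s3 s4 : ℝ) (ha : 0 ≤ a) (hb : 0 ≤ b) (hc : 0 ≤ c) (hd : 0 ≤ d)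
    (hr : 0 ≤ r) (h : a+b+c+d+r = 1) (h1 : s1 = 0 ∨ s1 = 1) (h2 : s2 = 0 ∨ s2 = 1)
    (h3 : s3 = 0 ∨ s3 = 1) (h4 : s4 = 0 ∨ s4 = 1) :
    6*(a*b*c+a*b*d+a*c*d+b*c*d) + 3*r*(a*b*(2-s1*s2)+a*c*(2-s1*s3)+a*d*(2-s1*s4)
      +b*c*(2-s2*s3)+b*d*(2-s2*s4)+c*d*(2-s3*s4)) + 3*r^2*(a*s1+b*s2+c*s3+d*s4)
      ≤ 577/1000 := by
  have hra : 0 ≤ r^2*a := by positivity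
  rcases h1 with rfl | rfl <;> rcases h2 with rfl | rfl <;> rcases h3 with rfl | rfl <;>
    rcases h4 with rfl | rfl
  · linarith [q1 a b c d r ha hb hc hd hr h]
  · linarith [q1 d b c a r hd hb hc ha hr (by linarith)]
  · linarith [q1 c b a d r hc hb ha hd hr (by linarith)]
  · linarith [q2 c d a b r hc hd ha hb hr (by linarith)]
  · linarith [q1 b a c d r hb ha hc hd hr (by linarith)]
  · linarith [q2 b d a c r hb hd ha hc hr (by linarith)]
  · linarith [q2 b c a d r hb hc ha hd hr (by linarith)]
  · linarith [q3 b c d a r hb hc hd ha hr (by linarith)]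
  · linarith [q1 a b c d r ha hb hc hd hr h]
  · linarith [q2 a d b c r ha hd hb hc hr (by linarith)]
  · linarith [q2 a c b d r ha hc hb hd hr (by linarith)]
  · linarith [q3 a c d b r ha hc hd hb hr (by linarith)]
  · linarith [q2 a b c d r ha hb hc hd hr (by linarith)]
  · linarith [q3 a b d c r ha hb hd hc hr (by linarith)]
  · linarith [q3 a b c d r ha hb hc hd hr (by linarith)]
  · linarith [q4 a b c d r ha hb hc hd hr h]

/-- the star bound -/
theorem star_bound (y : ℝ) (h1 : y ≤ 1/2) :
    y*(1-2*y)*(1-y) ≤ Real.sqrt 3 / 18 := by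
  have hs : Real.sqrt 3 ^ 2 = 3 := Real.sq_sqrt (by norm_num)
  have h0 : 0 ≤ Real.sqrt 3 := Real.sqrt_nonneg 3
  set s := Real.sqrt 3
  have hk : 0 ≤ (y - (3 - s)/6)^2 * (1/2 + s/3 - y) :=
    mul_nonneg (sq_nonneg _) (by linarith)
  have e : 2 * ((y - (3 - s)/6)^2 * (1/2 + s/3 - y)) = s/18 - y*(1-2*y)*(1-y) := by
    have h3 : s^3 = 3*s := by rw [pow_succ, hs]
    ring_nf
    rw [h3, hs]
    ring
  linarith

theorem c577 : (577:ℝ)/1000 ≤ Real.sqrt 3 / 3 := by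
  have : (1731:ℝ)/1000 ≤ Real.sqrt 3 := Real.le_sqrt_of_sq_le (by norm_num)
  linarith

theorem nu3 (x1 x2 a b c d e f w : ℝ) (h1 : 0 ≤ x1) (h2 : 0 ≤ x2) (ha : 0 ≤ a) (hb : 0 ≤ b)
    (hc : 0 ≤ c) (hd : 0 ≤ d) (he : 0 ≤ e) (hf : 0 ≤ f) (hw : x1 + x2 + w = 1)
    (hle : a+b+c+d+e+f ≤ w) :
    x1*x2*w + (x1+x2)/2*(w^2-(a^2+b^2+c^2+d^2+e^2+f^2)) + (a+b)*(c+d)*(e+f)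
      ≤ Real.sqrt 3 / 18 := by
  obtain ⟨y, hy⟩ : ∃ y, y = (x1+x2)/2 := ⟨_, rfl⟩
  obtain ⟨t, ht⟩ : ∃ t, t = a+b+c+d+e+f := ⟨_, rfl⟩
  have ht0 : 0 ≤ t := by rw [ht]; positivity
  have hw' : w = 1 - 2*y := by linarith
  have hy0 : 0 ≤ y := by rw [hy]; positivity
  have hw0 : 0 ≤ w := by linarith
  have hsq : t^2/6 ≤ a^2+b^2+c^2+d^2+e^2+f^2 := by
    rw [ht]
    nlinarith [sq_nonneg (a-b), sq_nonneg (a-c), sq_nonneg (a-d), sq_nonneg (a-e), sq_nonneg (a-f),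
      sq_nonneg (b-c), sq_nonneg (b-d), sq_nonneg (b-e), sq_nonneg (b-f), sq_nonneg (c-d),
      sq_nonneg (c-e), sq_nonneg (c-f), sq_nonneg (d-e), sq_nonneg (d-f), sq_nonneg (e-f)]
  have hcube : (a+b)*(c+d)*(e+f) ≤ t^3/27 := by
    have := e3_three (a+b) (c+d) (e+f) (by positivity) (by positivity) (by positivity)
    rw [show a+b+(c+d)+(e+f) = t by rw [ht]; ring] at this
    exact this
  have hxx : x1*x2 ≤ y^2 := by rw [hy]; nlinarith [sq_nonneg (x1-x2)]
  have e1 := mul_le_mul_of_nonneg_right hxx hw0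
  have e2 := mul_le_mul_of_nonneg_left hsq hy0
  rw [← hy]
  have main : x1*x2*w + y*(w^2-(a^2+b^2+c^2+d^2+e^2+f^2)) + (a+b)*(c+d)*(e+f)
      ≤ y*(1-2*y)*(1-y) + t^2*(t/27-y/6) := by
    have : y^2*w + y*w^2 = y*(1-2*y)*(1-y) := by rw [hw']; ring
    nlinarith
  refine main.trans ?_
  rcases le_total (t/27) (y/6) with h | h
  · have := star_bound y (by linarith)
    have : t^2*(t/27-y/6) ≤ 0 := mul_nonpos_of_nonneg_of_nonpos (sq_nonneg t) (by linarith)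
    linarith
  · have htw : t ≤ w := by rw [ht]; exact hle
    have k1 : t^2*(t/27-y/6) ≤ w^2*(w/27-y/6) :=
      mul_le_mul (pow_le_pow_left₀ ht0 htw 2) (by linarith) (by linarith) (sq_nonneg w)
    have k2 : y*(1-2*y)*(1-y) + (1-2*y)^2*((1-2*y)/27-y/6) ≤ 577/6000 := by
      have : 0 ≤ 1 - 2*y := by linarith
      nlinarith [mul_nonneg hy0 (sq_nonneg (y - 1/5)), mul_nonneg this (sq_nonneg (y-1/5)),
        mul_nonneg hy0 (sq_nonneg (y - 1/4)), mul_nonneg this (sq_nonneg (y-1/4)), mul_nonneg hy0 this]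
    rw [hw'] at k1
    have := c577
    linarith

theorem nu2_pair (r m n A B g k : ℝ) (hA : 0 ≤ A) (hB : 0 ≤ B) (hn : 0 ≤ n)
    (hnr : n ≤ r) (hnm : n ≤ m) (hor : n = r ∨ n = m) (hg : g = 0 ∨ g = 1) (hk : k = 0 ∨ k = 1) :
    g*(r*A-m*B)+k*(r*B-m*A) ≤ (r-n)*(A+B)+n*|A-B| := by
  have a1 : n*(A-B) ≤ n*|A-B| := mul_le_mul_of_nonneg_left (le_abs_self _) hn
  have a2 : n*(B-A) ≤ n*|A-B| := mul_le_mul_of_nonneg_left (by rw [abs_sub_comm]; exact le_abs_self _) hn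
  have a3 : 0 ≤ n*|A-B| := by positivity
  have b1 := mul_nonneg (sub_nonneg.2 hnr) hA
  have b2 := mul_nonneg (sub_nonneg.2 hnr) hB
  have b3 := mul_nonneg (sub_nonneg.2 hnm) hA
  have b4 := mul_nonneg (sub_nonneg.2 hnm) hB
  rcases hor with rfl | rfl <;> rcases hg with rfl | rfl <;> rcases hk with rfl | rfl <;> nlinarith

theorem nu2_S2a (y r n x3 x4 x5 x6 z : ℝ) (hn : 0 ≤ n) (hny : n ≤ y) (hnr : n ≤ r)
    (h3 : 0 ≤ x3) (h4 : 0 ≤ x4) (h5 : 0 ≤ x5) (h6 : 0 ≤ x6) (hz : z = (x3+x4)*(x5-x6)) :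
    -y*(x3^2+x4^2+x5^2+x6^2) + (x3*x4*x5+x3*x4*x6+x3*x5*x6+x4*x5*x6)
      + (r-n)*((x3+x4)*(x5+x6)) + n*z
      ≤ -y*((x3+x4+x5+x6)/2)^2 + ((x3+x4+x5+x6)/2)^3/2 + (r-n)*((x3+x4+x5+x6)/2)^2
        + 3/5*n*((x3+x4+x5+x6)/2)^2 := by
  subst hz
  obtain ⟨α, hα⟩ : ∃ α, α = x3+x4 := ⟨_, rfl⟩
  obtain ⟨β, hβ⟩ : ∃ β, β = x5+x6 := ⟨_, rfl⟩
  obtain ⟨e, he⟩ : ∃ e, e = x5-x6 := ⟨_, rfl⟩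
  have hα0 : 0 ≤ α := by rw [hα]; positivity
  have hβ0 : 0 ≤ β := by rw [hβ]; positivity
  have hy : 0 ≤ y := hn.trans hny
  have i1 : α^2/2 ≤ x3^2+x4^2 := by rw [hα]; nlinarith [sq_nonneg (x3-x4)]
  have i2 : x3*x4 ≤ α^2/4 := by rw [hα]; nlinarith [sq_nonneg (x3-x4)]
  have i3 : x5^2+x6^2 = β^2/2+e^2/2 := by rw [hβ, he]; ring
  have i4 : x5*x6 ≤ β^2/4 := by rw [hβ]; nlinarith [sq_nonneg (x5-x6)]
  have heβ : e ≤ β := by linarith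
  have j : α*e - e^2/2 - ((β-α)/2)^2 ≤ 3/5*((α+β)/2)^2 := by
    rcases le_total β α with h | h
    · nlinarith [mul_nonneg (sub_nonneg.2 heβ) (sub_nonneg.2 h), sq_nonneg (e-β),
        sq_nonneg ((α+β)/2 + 5*((β-α)/2))]
    · nlinarith [sq_nonneg (e-α), mul_nonneg hα0 (sub_nonneg.2 h)]
  have jn := mul_le_mul_of_nonneg_left j hn
  have k1 := mul_le_mul_of_nonneg_left i1 hy
  have k2 := mul_le_mul_of_nonneg_right i2 hβ0
  have k3 := mul_le_mul_of_nonneg_right i4 hα0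
  have k4 : α*β*(α+β)/4 ≤ ((α+β)/2)^3/2 := by
    nlinarith [mul_nonneg (add_nonneg hα0 hβ0) (sq_nonneg (α-β))]
  have k5 : (r-n)*(α*β) ≤ (r-n)*((α+β)/2)^2 :=
    mul_le_mul_of_nonneg_left (by nlinarith [sq_nonneg (α-β)]) (sub_nonneg.2 hnr)
  have k6 := mul_nonneg (sub_nonneg.2 hny) (sq_nonneg e)
  have k7 := mul_nonneg (sub_nonneg.2 hny) (sq_nonneg (β-α))
  rw [show (x3+x4+x5+x6)/2 = (α+β)/2 by rw [hα, hβ]; ring, ← hα, ← hβ, ← he,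
    show x3*x4*x5+x3*x4*x6+x3*x5*x6+x4*x5*x6 = x3*x4*β + x5*x6*α by rw [hα, hβ]; ring,
    show x3^2+x4^2+x5^2+x6^2 = (x3^2+x4^2)+(β^2/2+e^2/2) by rw [← i3]; ring]
  linarith

theorem nu2_S2 (y r n x3 x4 x5 x6 : ℝ) (hn : 0 ≤ n) (hny : n ≤ y) (hnr : n ≤ r)
    (h3 : 0 ≤ x3) (h4 : 0 ≤ x4) (h5 : 0 ≤ x5) (h6 : 0 ≤ x6) :
    -y*(x3^2+x4^2+x5^2+x6^2) + (x3*x4*x5+x3*x4*x6+x3*x5*x6+x4*x5*x6)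
      + (r-n)*((x3+x4)*(x5+x6)) + n*(|x3*x5-x4*x6| + |x3*x6-x4*x5|)
      ≤ -y*((x3+x4+x5+x6)/2)^2 + ((x3+x4+x5+x6)/2)^3/2 + (r-n)*((x3+x4+x5+x6)/2)^2
        + 3/5*n*((x3+x4+x5+x6)/2)^2 := by
  have f1 : x3+x4+x6+x5 = x3+x4+x5+x6 := by ring
  have f2 : x5+x6+x3+x4 = x3+x4+x5+x6 := by ring
  have f3 : x5+x6+x4+x3 = x3+x4+x5+x6 := by ring
  rcases abs_cases (x3*x5-x4*x6) with ⟨h, -⟩ | ⟨h, -⟩ <;>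
    rcases abs_cases (x3*x6-x4*x5) with ⟨k, -⟩ | ⟨k, -⟩ <;> rw [h, k]
  · have := nu2_S2a y r n x5 x6 x3 x4 _ hn hny hnr h5 h6 h3 h4 rfl
    rw [f2] at this
    linarith
  · have := nu2_S2a y r n x3 x4 x5 x6 _ hn hny hnr h3 h4 h5 h6 rfl
    linarith
  · have := nu2_S2a y r n x3 x4 x6 x5 _ hn hny hnr h3 h4 h6 h5 rfl
    rw [f1] at this
    linarith
  · have := nu2_S2a y r n x5 x6 x4 x3 _ hn hny hnr h5 h6 h4 h3 rfl
    rw [f3] at this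
    linarith

theorem nu2_aux (m d x3 x4 x5 x6 p q g35 g36 g45 g46 : ℝ) (hm : 0 ≤ m) (hd : 0 ≤ d)
    (h3 : 0 ≤ x3) (h4 : 0 ≤ x4) (h5 : 0 ≤ x5) (h6 : 0 ≤ x6) (hp : 0 ≤ p) (hq : 0 ≤ q)
    (hs : 2*m + d + (x3+x4+x5+x6) + (p+q) = 1)
    (H35 : g35 = 0 ∨ g35 = 1) (H36 : g36 = 0 ∨ g36 = 1) (H45 : g45 = 0 ∨ g45 = 1)
    (H46 : g46 = 0 ∨ g46 = 1) :
    m*(m+d)*(x3+x4+x5+x6+p) + (m+d/2)*((x3+x4+x5+x6+p+q)^2 - (x3^2+x4^2+x5^2+x6^2))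
      + (x3*x4*x5+x3*x4*x6+x3*x5*x6+x4*x5*x6)
      + (g35*((p+q)*(x3*x5)-m*(x4*x6)) + g46*((p+q)*(x4*x6)-m*(x3*x5)))
      + (g36*((p+q)*(x3*x6)-m*(x4*x5)) + g45*((p+q)*(x4*x5)-m*(x3*x6)))
      - m*p^2/2 ≤ 577/6000 := by
  obtain ⟨r, hr⟩ : ∃ r, r = p+q := ⟨_, rfl⟩
  obtain ⟨h, hh⟩ : ∃ h, h = (x3+x4+x5+x6)/2 := ⟨_, rfl⟩
  have hr0 : 0 ≤ r := by rw [hr]; positivity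
  have hh0 : 0 ≤ h := by rw [hh]; positivity
  -- everything for a given threshold n
  have key : ∀ n, 0 ≤ n → n ≤ r → n ≤ m → (n = r ∨ n = m) →
      m*(m+d)*(x3+x4+x5+x6+p) + (m+d/2)*((x3+x4+x5+x6+p+q)^2 - (x3^2+x4^2+x5^2+x6^2))
      + (x3*x4*x5+x3*x4*x6+x3*x5*x6+x4*x5*x6)
      + (g35*((p+q)*(x3*x5)-m*(x4*x6)) + g46*((p+q)*(x4*x6)-m*(x3*x5)))
      + (g36*((p+q)*(x3*x6)-m*(x4*x5)) + g45*((p+q)*(x4*x5)-m*(x3*x6)))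
      - m*p^2/2 ≤ m*(m+d)*(2*h+r) + (m+d/2)*(2*h+r)^2 + (-(m+d/2)*h^2 + h^3/2 + (r-n)*h^2
        + 3/5*n*h^2) - m*(n*r-n^2/2) := by
    intro n hn hnr hnm hor
    have a1 := nu2_pair r m n (x3*x5) (x4*x6) g35 g46 (by positivity) (by positivity) hn hnr hnm hor
      H35 H46
    have a2 := nu2_pair r m n (x3*x6) (x4*x5) g36 g45 (by positivity) (by positivity) hn hnr hnm hor
      H36 H45
    have a3 := nu2_S2 (m+d/2) r n x3 x4 x5 x6 hn (by linarith) hnr h3 h4 h5 h6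
    rw [← hh] at a3
    rw [← hr]
    have e1 : x3+x4+x5+x6 = 2*h := by rw [hh]; ring
    have e2 : x3+x4+x5+x6+p+q = 2*h+r := by rw [hr, hh]; ring
    rw [e2, e1]
    have b1 : m*(n*r-n^2/2) ≤ m*(m+d)*q + m*p^2/2 := by
      have c1 : n*r - n^2/2 ≤ (m+d)*q + p^2/2 := by
        rw [hr]
        nlinarith [sq_nonneg (p-n), mul_nonneg (sub_nonneg.2 (hnm.trans (by linarith : m ≤ m+d))) hq]
      nlinarith [mul_le_mul_of_nonneg_left c1 hm]
    have b2 : m*(m+d)*(2*h+p) = m*(m+d)*(2*h+r) - m*(m+d)*q := by rw [hr]; ring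
    rw [b2]
    linarith
  rcases le_total r m with hrm | hmr
  · refine (key r hr0 le_rfl hrm (Or.inl rfl)).trans ?_
    have a := mode4h (m+d/2) h r (by positivity) hh0 hr0
    rw [show 2*(m+d/2)+2*h+r = 1 by rw [hh, hr]; linarith, one_pow, mul_one] at a
    have b1 : 0 ≤ d^2/4*(2*h+r) := by positivity
    have b2 := mul_le_mul_of_nonneg_right hrm (sq_nonneg r)
    linarith
  · refine (key m hm hmr le_rfl (Or.inr rfl)).trans ?_
    have a := mode3h m d h r hm hd hh0 hr0
    rw [show 2*m+d+2*h+r = 1 by rw [hh, hr]; linarith, one_pow, mul_one] at a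
    linarith


theorem nu2_all (x1 x2 m x3 x4 x5 x6 p q g35 g36 g45 g46 : ℝ) (h1 : 0 ≤ x1) (h2 : 0 ≤ x2)
    (hm : m = min x1 x2)
    (h3 : 0 ≤ x3) (h4 : 0 ≤ x4) (h5 : 0 ≤ x5) (h6 : 0 ≤ x6) (hp : 0 ≤ p) (hq : 0 ≤ q)
    (hs : x1 + x2 + (x3+x4+x5+x6) + (p+q) = 1)
    (H35 : g35 = 0 ∨ g35 = 1) (H36 : g36 = 0 ∨ g36 = 1) (H45 : g45 = 0 ∨ g45 = 1)
    (H46 : g46 = 0 ∨ g46 = 1) :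
    x1*x2*(x3+x4+x5+x6+p) + (x1+x2)/2*((x3+x4+x5+x6+p+q)^2 - (x3^2+x4^2+x5^2+x6^2))
      + (x3*x4*x5+x3*x4*x6+x3*x5*x6+x4*x5*x6)
      + (g35*((p+q)*(x3*x5)-m*(x4*x6)) + g46*((p+q)*(x4*x6)-m*(x3*x5)))
      + (g36*((p+q)*(x3*x6)-m*(x4*x5)) + g45*((p+q)*(x4*x5)-m*(x3*x6)))
      - m*p^2/2 ≤ 577/6000 := by
  rcases le_total x1 x2 with h | h
  · rw [min_eq_left h] at hm
    have := nu2_aux x1 (x2 - x1) x3 x4 x5 x6 p q g35 g36 g45 g46 h1 (by linarith) h3 h4 h5 h6 hp hq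
      (by linarith) H35 H36 H45 H46
    rw [show x1 + (x2 - x1)/2 = (x1+x2)/2 by ring, show x1 + (x2 - x1) = x2 by ring] at this
    rw [hm]; exact this
  · rw [min_eq_right h] at hm
    have := nu2_aux x2 (x1 - x2) x3 x4 x5 x6 p q g35 g36 g45 g46 h2 (by linarith) h3 h4 h5 h6 hp hq
      (by linarith) H35 H36 H45 H46
    rw [show x2 + (x1 - x2)/2 = (x1+x2)/2 by ring, show x2 + (x1 - x2) = x1 by ring,
      mul_comm x2 x1] at this
    rw [hm]; exact this


section partB

/-- triple sums over finite sets -/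
noncomputable def S3 {V : Type*} (f : V → V → V → ℝ) (A B C : Finset V) : ℝ :=
  ∑ a ∈ A, ∑ b ∈ B, ∑ c ∈ C, f a b c

variable {V : Type*} [DecidableEq V]

theorem S3_swap12 (f : V → V → V → ℝ) (h1 : ∀ a b c, f a b c = f b a c) (A B C : Finset V) :
    S3 f A B C = S3 f B A C := by
  unfold S3
  rw [Finset.sum_comm]
  exact Finset.sum_congr rfl fun b _ => Finset.sum_congr rfl fun a _ =>
    Finset.sum_congr rfl fun c _ => h1 _ _ _

theorem S3_swap23 (f : V → V → V → ℝ) (h2 : ∀ a b c, f a b c = f a c b) (A B C : Finset V) :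
    S3 f A B C = S3 f A C B := by
  unfold S3
  refine Finset.sum_congr rfl fun a _ => ?_
  rw [Finset.sum_comm]
  exact Finset.sum_congr rfl fun b _ => Finset.sum_congr rfl fun c _ => h2 _ _ _

theorem S3_zero (f : V → V → V → ℝ) (A B C : Finset V)
    (h : ∀ a ∈ A, ∀ b ∈ B, ∀ c ∈ C, f a b c = 0) : S3 f A B C = 0 :=
  Finset.sum_eq_zero fun a ha => Finset.sum_eq_zero fun b hb => Finset.sum_eq_zero fun c hc =>
    h a ha b hb c hc

theorem S3_union1 (f : V → V → V → ℝ) (A A' B C : Finset V) (h : Disjoint A A') :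
    S3 f (A ∪ A') B C = S3 f A B C + S3 f A' B C := by
  unfold S3; rw [Finset.sum_union h]

theorem S3_union2 (f : V → V → V → ℝ) (A B B' C : Finset V) (h : Disjoint B B') :
    S3 f A (B ∪ B') C = S3 f A B C + S3 f A B' C := by
  unfold S3; simp only [Finset.sum_union h, Finset.sum_add_distrib]

theorem S3_union3 (f : V → V → V → ℝ) (A B C C' : Finset V) (h : Disjoint C C') :
    S3 f A B (C ∪ C') = S3 f A B C + S3 f A B C' := by
  unfold S3; simp only [Finset.sum_union h, Finset.sum_add_distrib]

theorem S3_split (f : V → V → V → ℝ) (h1 : ∀ a b c, f a b c = f b a c)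
    (h2 : ∀ a b c, f a b c = f a c b) (A B : Finset V) (h : Disjoint A B) :
    S3 f (A ∪ B) (A ∪ B) (A ∪ B) = S3 f A A A + 3 * S3 f A A B + 3 * S3 f A B B + S3 f B B B := by
  simp only [S3_union1 f _ _ _ _ h, S3_union2 f _ _ _ _ h, S3_union3 f _ _ _ _ h]
  rw [S3_swap12 f h1 B A A, S3_swap23 f h2 A B A, S3_swap12 f h1 B A B, S3_swap23 f h2 B B A,
    S3_swap12 f h1 B A B]
  ring

theorem sum_two {a b : V} (h : a ≠ b) (g : V → ℝ) : ∑ i ∈ ({a, b} : Finset V), g i = g a + g b :=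
  Finset.sum_pair h

theorem sum_four {a b c d : V} (hab : a ≠ b) (hac : a ≠ c) (had : a ≠ d) (hbc : b ≠ c)
    (hbd : b ≠ d) (hcd : c ≠ d) (g : V → ℝ) :
    ∑ i ∈ ({a, b, c, d} : Finset V), g i = g a + g b + g c + g d := by
  rw [Finset.sum_insert (by simp [hab, hac, had]), Finset.sum_insert (by simp [hbc, hbd]),
    Finset.sum_pair hcd]
  ring

/-- indicator of an edge -/
noncomputable def ind (e : V → V → V → Bool) (a b c : V) : ℝ := if e a b c = true then 1 else 0

/-- weighted indicator -/
noncomputable def wt (e : V → V → V → Bool) (x : V → ℝ) (a b c : V) : ℝ :=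
  x a * x b * x c * ind e a b c

/-- symmetric and irreflexive -/
structure SymIrr (e : V → V → V → Bool) : Prop where
  s1 : ∀ a b c, e a b c = e b a c
  s2 : ∀ a b c, e a b c = e a c b
  ir : ∀ a b, e a a b = false

/-- complete four-vertex subgraph -/
def IsK4 (e : V → V → V → Bool) (a b c d : V) : Prop :=
  e a b c = true ∧ e a b d = true ∧ e a c d = true ∧ e b c d = true

/-- all edges meet all complete four-vertex subgraphs -/
def Meets (e : V → V → V → Bool) : Prop :=
  ∀ a b c d, IsK4 e a b c d → ∀ u v w, e u v w = true →
    u ∈ ({a, b, c, d} : Finset V) ∨ v ∈ ({a, b, c, d} : Finset V) ∨ w ∈ ({a, b, c, d} : Finset V)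

theorem ind_01 (e : V → V → V → Bool) (a b c : V) : ind e a b c = 0 ∨ ind e a b c = 1 := by
  unfold ind; split <;> simp

theorem ind_nonneg (e : V → V → V → Bool) (a b c : V) : 0 ≤ ind e a b c := by
  rcases ind_01 e a b c with h | h <;> rw [h] <;> norm_num

theorem ind_le_one (e : V → V → V → Bool) (a b c : V) : ind e a b c ≤ 1 := by
  rcases ind_01 e a b c with h | h <;> rw [h] <;> norm_num

theorem ind_eq_one {e : V → V → V → Bool} {a b c : V} (h : e a b c = true) : ind e a b c = 1 := by
  simp [ind, h]

theorem ind_eq_zero {e : V → V → V → Bool} {a b c : V} (h : ¬ e a b c = true) :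
    ind e a b c = 0 := by
  simp [ind, h]

theorem wt_s1 {e : V → V → V → Bool} (he : SymIrr e) (x : V → ℝ) (a b c : V) :
    wt e x a b c = wt e x b a c := by
  unfold wt ind; rw [he.s1 a b c]; ring

theorem wt_s2 {e : V → V → V → Bool} (he : SymIrr e) (x : V → ℝ) (a b c : V) :
    wt e x a b c = wt e x a c b := by
  unfold wt ind; rw [he.s2 a b c]; ring

theorem wt_ir {e : V → V → V → Bool} (he : SymIrr e) (x : V → ℝ) (a b : V) :
    wt e x a a b = 0 := by
  unfold wt ind; rw [he.ir a b]; simp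

theorem wt_le {e : V → V → V → Bool} {x : V → ℝ} (hx : ∀ v, 0 ≤ x v) (a b c : V) :
    wt e x a b c ≤ x a * x b * x c := by
  have := hx a; have := hx b; have := hx c
  exact mul_le_of_le_one_right (by positivity) (ind_le_one e a b c)

theorem wt_zero {e : V → V → V → Bool} (x : V → ℝ) {a b c : V} (h : ¬ e a b c = true) :
    wt e x a b c = 0 := by
  unfold wt; rw [ind_eq_zero h, mul_zero]

theorem pair_sum_four {a b c d : V} (hab : a ≠ b) (hac : a ≠ c) (had : a ≠ d) (hbc : b ≠ c)
    (hbd : b ≠ d) (hcd : c ≠ d) (g : V → V → ℝ) (hs : ∀ i j, g i j = g j i) (hz : ∀ i, g i i = 0) :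
    ∑ i ∈ ({a, b, c, d} : Finset V), ∑ j ∈ ({a, b, c, d} : Finset V), g i j
      = 2 * (g a b + g a c + g a d + g b c + g b d + g c d) := by
  simp only [sum_four hab hac had hbc hbd hcd, hz]
  rw [hs b a, hs c a, hs d a, hs c b, hs d b, hs d c]
  ring

theorem S3_four {a b c d : V} (hab : a ≠ b) (hac : a ≠ c) (had : a ≠ d) (hbc : b ≠ c)
    (hbd : b ≠ d) (hcd : c ≠ d) (f : V → V → V → ℝ) (h1 : ∀ a b c, f a b c = f b a c)
    (h2 : ∀ a b c, f a b c = f a c b) (hz : ∀ a b, f a a b = 0) :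
    S3 f {a, b, c, d} {a, b, c, d} {a, b, c, d}
      = 6 * (f a b c + f a b d + f a c d + f b c d) := by
  have hz2 : ∀ i j, f i j j = 0 := fun i j => by rw [h1, h2, hz]
  have hz3 : ∀ i j, f i j i = 0 := fun i j => by rw [h2, hz]
  have e1 : ∀ i, ∑ j ∈ ({a, b, c, d} : Finset V), ∑ k ∈ ({a, b, c, d} : Finset V), f i j k
      = 2 * (f i a b + f i a c + f i a d + f i b c + f i b d + f i c d) := fun i =>
    pair_sum_four hab hac had hbc hbd hcd (f i) (fun j k => h2 i j k) (hz2 i)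
  unfold S3
  rw [Finset.sum_congr rfl fun i _ => e1 i, sum_four hab hac had hbc hbd hcd]
  simp only [hz, hz2, hz3]
  have rot : ∀ i j k, f k i j = f i j k := fun i j k => by rw [h1 k i j, h2 i k j]
  rw [h1 b a c, h1 b a d, h1 c a d, h1 c b d, rot a b c, rot a b d, rot a c d, rot b c d]
  ring

theorem caseII [Fintype V] (e : V → V → V → Bool) (he : SymIrr e) (hm : Meets e) (x : V → ℝ)
    (hx : ∀ v, 0 ≤ x v) (hsum : ∑ v, x v = 1) (a b c d : V) (hK : IsK4 e a b c d)
    (hab : a ≠ b) (hac : a ≠ c) (had : a ≠ d) (hbc : b ≠ c) (hbd : b ≠ d) (hcd : c ≠ d)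
    (hno : ∀ i ∈ ({a, b, c, d} : Finset V), ∀ j ∈ ({a, b, c, d} : Finset V), i ≠ j →
      ∀ u v, u ∉ ({a, b, c, d} : Finset V) → v ∉ ({a, b, c, d} : Finset V) → ¬ IsK4 e u v i j) :
    S3 (wt e x) univ univ univ ≤ 577/1000 := by
  set K : Finset V := {a, b, c, d} with hKd
  have hU : (univ : Finset V) = K ∪ Kᶜ := (Finset.union_compl K).symm
  have hdis : Disjoint K Kᶜ := disjoint_compl_right
  rw [hU, S3_split _ (wt_s1 he x) (wt_s2 he x) K Kᶜ hdis,
    S3_swap23 _ (wt_s2 he x) K K Kᶜ, S3_swap12 _ (wt_s1 he x) K Kᶜ K,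
    S3_swap12 _ (wt_s1 he x) K Kᶜ Kᶜ, S3_swap23 _ (wt_s2 he x) Kᶜ K Kᶜ]
  have hRRR : S3 (wt e x) Kᶜ Kᶜ Kᶜ = 0 := by
    refine S3_zero _ _ _ _ fun u hu v hv w hw => wt_zero x fun h => ?_
    rw [Finset.mem_compl] at hu hv hw
    rcases hm a b c d hK u v w h with h | h | h
    exacts [hu h, hv h, hw h]
  set R := Kᶜ with hR
  obtain ⟨r, hr⟩ : ∃ r, r = ∑ u ∈ R, x u := ⟨_, rfl⟩
  have hr0 : 0 ≤ r := by rw [hr]; exact Finset.sum_nonneg fun u _ => hx u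
  have hs4 := sum_four hab hac had hbc hbd hcd
  have hone : x a + x b + x c + x d + r = 1 := by
    rw [← hsum, hU, Finset.sum_union hdis, hKd, hs4, hr]
  set N : V → ℝ := fun u => x a * x b * ind e u a b + x a * x c * ind e u a c
    + x a * x d * ind e u a d + x b * x c * ind e u b c + x b * x d * ind e u b d
    + x c * x d * ind e u c d with hN
  set S : V → V → ℝ := fun u v => x a * ind e u v a + x b * ind e u v b + x c * ind e u v c
    + x d * ind e u v d with hS
  set e3 := x a * x b * x c + x a * x b * x d + x a * x c * x d + x b * x c * x d with he3
  have hKKK : S3 (wt e x) K K K ≤ 6 * e3 := by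
    rw [hKd, S3_four hab hac had hbc hbd hcd _ (wt_s1 he x) (wt_s2 he x) (wt_ir he x)]
    have t1 := wt_le (e := e) hx a b c
    have t2 := wt_le (e := e) hx a b d
    have t3 := wt_le (e := e) hx a c d
    have t4 := wt_le (e := e) hx b c d
    linarith
  have hRKK : S3 (wt e x) R K K = 2 * ∑ u ∈ R, x u * N u := by
    unfold S3
    rw [Finset.mul_sum]
    refine Finset.sum_congr rfl fun u _ => ?_
    rw [hKd, pair_sum_four hab hac had hbc hbd hcd (fun i j => wt e x u i j)
      (fun i j => wt_s2 he x u i j) (fun i => by rw [wt_s1 he, wt_s2 he, wt_ir he])]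
    simp only [wt, hN]
    ring
  have hRRK : S3 (wt e x) R R K = ∑ u ∈ R, ∑ v ∈ R, x u * x v * S u v := by
    unfold S3
    refine Finset.sum_congr rfl fun u _ => Finset.sum_congr rfl fun v _ => ?_
    rw [hKd, hs4]
    simp only [wt, hS]
    ring
  have hmain : ∀ u ∈ R, ∀ v ∈ R, 6 * e3 + 3 * r * (N u + N v) + 3 * r^2 * S u v ≤ 577/1000 := by
    intro u hu v hv
    have hu' : u ∉ K := by rwa [hR, Finset.mem_compl] at hu
    have hv' : v ∉ K := by rwa [hR, Finset.mem_compl] at hv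
    have hq := qII (x a) (x b) (x c) (x d) r (ind e u v a) (ind e u v b) (ind e u v c) (ind e u v d)
      (hx a) (hx b) (hx c) (hx d) hr0 hone (ind_01 _ _ _ _) (ind_01 _ _ _ _) (ind_01 _ _ _ _)
      (ind_01 _ _ _ _)
    have pr : ∀ i ∈ K, ∀ j ∈ K, i ≠ j → x i * x j * ind e u i j + x i * x j * ind e v i j
        ≤ x i * x j * (2 - ind e u v i * ind e u v j) := by
      intro i hi j hj hij
      have hxx : 0 ≤ x i * x j := mul_nonneg (hx i) (hx j)
      rw [← mul_add]
      refine mul_le_mul_of_nonneg_left ?_ hxx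
      by_cases h1 : e u v i = true
      · by_cases h2 : e u v j = true
        · rw [ind_eq_one h1, ind_eq_one h2]
          by_cases h3 : e u i j = true
          · have h4 : ¬ e v i j = true := fun h4 => hno i hi j hj hij u v hu' hv' ⟨h1, h2, h3, h4⟩
            rw [ind_eq_zero h4]; linarith [ind_le_one e u i j]
          · rw [ind_eq_zero h3]; linarith [ind_le_one e v i j]
        · rw [ind_eq_zero h2]; linarith [ind_le_one e u i j, ind_le_one e v i j]
      · rw [ind_eq_zero h1]; linarith [ind_le_one e u i j, ind_le_one e v i j]
    have ma : a ∈ K := by simp [hKd]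
    have mb : b ∈ K := by simp [hKd]
    have mc : c ∈ K := by simp [hKd]
    have md : d ∈ K := by simp [hKd]
    have hNN : N u + N v ≤ x a*x b*(2-ind e u v a*ind e u v b)+x a*x c*(2-ind e u v a*ind e u v c)
      +x a*x d*(2-ind e u v a*ind e u v d) +x b*x c*(2-ind e u v b*ind e u v c)
      +x b*x d*(2-ind e u v b*ind e u v d)+x c*x d*(2-ind e u v c*ind e u v d) := by
      simp only [hN]
      linarith [pr a ma b mb hab, pr a ma c mc hac, pr a ma d md had, pr b mb c mc hbc,
        pr b mb d md hbd, pr c mc d md hcd]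
    have h3 := mul_le_mul_of_nonneg_left hNN (mul_nonneg (by norm_num : (0:ℝ) ≤ 3) hr0)
    simp only [hS]
    linarith
  rw [hRRR, hRKK, hRRK]
  rcases hr0.eq_or_lt with h0 | hpos
  · have hz : ∀ u ∈ R, x u = 0 := by
      rw [← h0] at hr
      exact (Finset.sum_eq_zero_iff_of_nonneg fun u _ => hx u).1 hr.symm
    have z1 : ∑ u ∈ R, x u * N u = 0 := Finset.sum_eq_zero fun u hu => by rw [hz u hu, zero_mul]
    have z2 : ∑ u ∈ R, ∑ v ∈ R, x u * x v * S u v = 0 := Finset.sum_eq_zero fun u hu =>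
      Finset.sum_eq_zero fun v _ => by rw [hz u hu, zero_mul, zero_mul]
    rw [z1, z2]
    have hq := qII (x a) (x b) (x c) (x d) r 0 0 0 0
      (hx a) (hx b) (hx c) (hx d) hr0 hone (by simp) (by simp) (by simp) (by simp)
    rw [← h0] at hq
    linarith
  · have hsumle : ∑ u ∈ R, ∑ v ∈ R, x u * x v * (6 * e3 + 3 * r * (N u + N v) + 3 * r^2 * S u v)
        ≤ ∑ u ∈ R, ∑ v ∈ R, x u * x v * (577/1000) :=
      Finset.sum_le_sum fun u hu => Finset.sum_le_sum fun v hv =>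
        mul_le_mul_of_nonneg_left (hmain u hu v hv) (mul_nonneg (hx u) (hx v))
    have e1 : ∑ u ∈ R, ∑ v ∈ R, x u * x v * (577/1000) = 577/1000 * r^2 := by
      simp only [← Finset.sum_mul, ← Finset.mul_sum]
      rw [← hr]; ring
    have e2 : ∑ u ∈ R, ∑ v ∈ R, x u * x v * (6 * e3 + 3 * r * (N u + N v) + 3 * r^2 * S u v)
        = r^2 * (6 * e3 + 6 * ∑ u ∈ R, x u * N u + 3 * ∑ u ∈ R, ∑ v ∈ R, x u * x v * S u v) := by
      have t : ∀ u v, x u * x v * (6 * e3 + 3 * r * (N u + N v) + 3 * r^2 * S u v)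
        = (6 * e3) * (x u * x v) + (3 * r) * ((x u * N u) * x v) + (3 * r) * (x u * (x v * N v))
          + (3 * r^2) * (x u * x v * S u v) := fun u v => by ring
      simp only [t, Finset.sum_add_distrib, ← Finset.mul_sum, ← Finset.sum_mul]
      rw [← hr]; ring
    rw [e1, e2] at hsumle
    have : 6 * e3 + 6 * ∑ u ∈ R, x u * N u + 3 * ∑ u ∈ R, ∑ v ∈ R, x u * x v * S u v ≤ 577/1000 := by
      refine le_of_mul_le_mul_left ?_ (pow_pos hpos 2)
      linarith
    linarith


theorem S3_le {e : V → V → V → Bool} {x : V → ℝ} (hx : ∀ v, 0 ≤ x v) (A B C : Finset V) :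
    S3 (wt e x) A B C ≤ (∑ a ∈ A, x a) * (∑ b ∈ B, x b) * (∑ c ∈ C, x c) := by
  have : S3 (fun a b c => x a * x b * x c) A B C
      = (∑ a ∈ A, x a) * (∑ b ∈ B, x b) * (∑ c ∈ C, x c) := by
    unfold S3
    simp only [← Finset.mul_sum, ← Finset.sum_mul]
  rw [← this]
  exact Finset.sum_le_sum fun a _ => Finset.sum_le_sum fun b _ => Finset.sum_le_sum fun c _ =>
    wt_le hx a b c

theorem S3_pair_split [Fintype V] {e : V → V → V → Bool} (he : SymIrr e) (x : V → ℝ) {p q : V}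
    (hpq : p ≠ q) (W : Finset V) (hW : W = ({p, q} : Finset V)ᶜ) :
    S3 (wt e x) univ univ univ = 6 * ∑ u ∈ W, wt e x p q u
      + 3 * (∑ u ∈ W, ∑ v ∈ W, (wt e x p u v + wt e x q u v)) + S3 (wt e x) W W W := by
  have hU : (univ : Finset V) = {p, q} ∪ W := by rw [hW, Finset.union_compl]
  have hdis : Disjoint ({p, q} : Finset V) W := by rw [hW]; exact disjoint_compl_right
  rw [hU, S3_split _ (wt_s1 he x) (wt_s2 he x) _ W hdis]
  have z1 : ∀ i j, wt e x i j j = 0 := fun i j => by rw [wt_s1 he, wt_s2 he, wt_ir he]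
  have z2 : ∀ i j, wt e x i j i = 0 := fun i j => by rw [wt_s2 he, wt_ir he]
  have h1 : S3 (wt e x) {p, q} {p, q} {p, q} = 0 := by
    unfold S3; simp only [sum_two hpq, z1, z2, wt_ir he]; norm_num
  have h2 : S3 (wt e x) {p, q} {p, q} W = 2 * ∑ u ∈ W, wt e x p q u := by
    unfold S3
    simp only [sum_two hpq, wt_ir he, Finset.sum_const_zero]
    rw [Finset.sum_congr rfl fun u _ => wt_s1 he x q p u]
    ring
  have h3 : S3 (wt e x) {p, q} W W = ∑ u ∈ W, ∑ v ∈ W, (wt e x p u v + wt e x q u v) := by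
    unfold S3
    rw [sum_two hpq]
    simp only [Finset.sum_add_distrib]
  rw [h1, h2, h3]
  ring

theorem caseI3 [Fintype V] (e : V → V → V → Bool) (he : SymIrr e) (hm : Meets e) (x : V → ℝ)
    (hx : ∀ v, 0 ≤ x v) (hsum : ∑ v, x v = 1) (p q a b c d s t : V) (hpq : p ≠ q)
    (h1 : IsK4 e p q a b) (h2 : IsK4 e p q c d) (h3 : IsK4 e p q s t)
    (hn : [p, q, a, b, c, d, s, t].Nodup) :
    S3 (wt e x) univ univ univ ≤ Real.sqrt 3 / 3 := by
  obtain ⟨W, hW⟩ : ∃ W, W = ({p, q} : Finset V)ᶜ := ⟨_, rfl⟩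
  rw [S3_pair_split he x hpq W hW]
  have hU : (univ : Finset V) = {p, q} ∪ W := by rw [hW, Finset.union_compl]
  have hdis : Disjoint ({p, q} : Finset V) W := by rw [hW]; exact disjoint_compl_right
  obtain ⟨w, hw⟩ : ∃ w, w = ∑ u ∈ W, x u := ⟨_, rfl⟩
  have hone : x p + x q + w = 1 := by
    rw [← hsum, hU, Finset.sum_union hdis, sum_two hpq, hw]
  have memW : ∀ u, u ∈ W ↔ u ≠ p ∧ u ≠ q := fun u => by rw [hW]; simp
  have mt : ∀ i j, IsK4 e p q i j → ∀ u ∈ W, ∀ v ∈ W, ∀ z ∈ W, e u v z = true →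
      (u = i ∨ u = j) ∨ (v = i ∨ v = j) ∨ (z = i ∨ z = j) := by
    intro i j hK u hu v hv z hz h
    rw [memW] at hu hv hz
    have := hm p q i j hK u v z h
    simp only [Finset.mem_insert, Finset.mem_singleton] at this
    tauto
  simp only [List.nodup_cons, List.mem_cons, List.not_mem_nil, or_false, not_or,
    not_false_eq_true, List.nodup_nil, and_true] at hn
  obtain ⟨⟨-, hpa, hpb, hpc, hpd, hps, hpt⟩, ⟨hqa, hqb, hqc, hqd, hqs, hqt⟩,
    ⟨hab, hac, had, has, hat⟩, ⟨hbc, hbd, hbs, hbt⟩, ⟨hcd, hcs, hct⟩, ⟨hds, hdt⟩, hst⟩ := hn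
  have wa : a ∈ W := (memW a).2 ⟨Ne.symm hpa, Ne.symm hqa⟩
  have wb : b ∈ W := (memW b).2 ⟨Ne.symm hpb, Ne.symm hqb⟩
  have wc : c ∈ W := (memW c).2 ⟨Ne.symm hpc, Ne.symm hqc⟩
  have wd : d ∈ W := (memW d).2 ⟨Ne.symm hpd, Ne.symm hqd⟩
  have ws : s ∈ W := (memW s).2 ⟨Ne.symm hps, Ne.symm hqs⟩
  have wtt : t ∈ W := (memW t).2 ⟨Ne.symm hpt, Ne.symm hqt⟩
  -- decomposition of W
  obtain ⟨R, hR⟩ : ∃ R, R = ((W \ {a, b}) \ {c, d}) \ {s, t} := ⟨_, rfl⟩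
  have hD : W = {a, b} ∪ ({c, d} ∪ ({s, t} ∪ R)) := by
    ext u
    simp only [hR, Finset.mem_union, Finset.mem_insert, Finset.mem_singleton, Finset.mem_sdiff]
    constructor
    · intro h; tauto
    · rintro ((rfl | rfl) | (rfl | rfl) | (rfl | rfl) | h) <;> tauto
  have memR : ∀ u, u ∈ R → u ∈ W ∧ u ≠ a ∧ u ≠ b ∧ u ≠ c ∧ u ≠ d ∧ u ≠ s ∧ u ≠ t := by
    intro u hu
    simp only [hR, Finset.mem_insert, Finset.mem_singleton, Finset.mem_sdiff] at hu
    tauto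
  have d3 : Disjoint ({s, t} : Finset V) R := by
    rw [hR]; exact Finset.disjoint_sdiff
  have d2 : Disjoint ({c, d} : Finset V) ({s, t} ∪ R) := by
    rw [Finset.disjoint_left]
    intro u hu hu2
    simp only [Finset.mem_union, Finset.mem_insert, Finset.mem_singleton] at hu hu2
    rcases hu2 with (h | h) | h
    · subst h; tauto
    · subst h; tauto
    · have := memR u h; tauto
  have d1 : Disjoint ({a, b} : Finset V) ({c, d} ∪ ({s, t} ∪ R)) := by
    rw [Finset.disjoint_left]
    intro u hu hu2
    simp only [Finset.mem_union, Finset.mem_insert, Finset.mem_singleton] at hu hu2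
    rcases hu2 with (h | h) | (h | h) | h
    · subst h; tauto
    · subst h; tauto
    · subst h; tauto
    · subst h; tauto
    · have := memR u h; tauto
  have hwle : x a + x b + x c + x d + x s + x t ≤ w := by
    rw [hw, hD, Finset.sum_union d1, Finset.sum_union d2, Finset.sum_union d3, sum_two hab,
      sum_two hcd, sum_two hst]
    linarith [Finset.sum_nonneg fun u (_ : u ∈ R) => hx u]
  have hsqle : x a^2 + x b^2 + x c^2 + x d^2 + x s^2 + x t^2 ≤ ∑ u ∈ W, x u^2 := by
    rw [hD, Finset.sum_union d1, Finset.sum_union d2, Finset.sum_union d3, sum_two hab,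
      sum_two hcd, sum_two hst]
    linarith [Finset.sum_nonneg fun u (_ : u ∈ R) => sq_nonneg (x u)]
  -- first sum
  have t1 : ∑ u ∈ W, wt e x p q u ≤ x p * x q * w := by
    rw [hw, Finset.mul_sum]
    exact Finset.sum_le_sum fun u _ => wt_le hx p q u
  -- second sum
  have t2 : ∑ u ∈ W, ∑ v ∈ W, (wt e x p u v + wt e x q u v)
      ≤ (x p + x q) * (w^2 - ∑ u ∈ W, x u^2) := by
    have e1 : (x p + x q) * (w^2 - ∑ u ∈ W, x u^2)
        = ∑ u ∈ W, ∑ v ∈ W, (x p + x q) * (x u * x v - if u = v then x u * x v else 0) := by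
      simp only [← Finset.mul_sum, Finset.sum_sub_distrib, Finset.sum_ite_eq]
      have hdg : ∑ u ∈ W, (if u ∈ W then x u * x u else 0) = ∑ u ∈ W, x u^2 :=
        Finset.sum_congr rfl fun u hu => by rw [if_pos hu, sq]
      rw [← Finset.sum_mul, ← hw, hdg]
      ring
    rw [e1]
    refine Finset.sum_le_sum fun u _ => Finset.sum_le_sum fun v _ => ?_
    by_cases huv : u = v
    · subst huv
      rw [wt_s1 he x p, wt_s2 he x u p, wt_ir he, wt_s1 he x q, wt_s2 he x u q, wt_ir he]
      simp
    · rw [if_neg huv]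
      linarith [wt_le (e := e) hx p u v, wt_le (e := e) hx q u v]
  -- third sum
  have t3 : S3 (wt e x) W W W ≤ 6 * ((x a + x b) * (x c + x d) * (x s + x t)) := by
    have sub1 : ∀ u, u ∈ ({a, b} : Finset V) → u ∈ W := fun u hu => by
      rw [hD]; exact Finset.mem_union_left _ hu
    have sub2 : ∀ u, u ∈ ({c, d} ∪ ({s, t} ∪ R) : Finset V) → u ∈ W := fun u hu => by
      rw [hD]; exact Finset.mem_union_right _ hu
    have sub3 : ∀ u, u ∈ ({c, d} : Finset V) → u ∈ W := fun u hu =>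
      sub2 u (Finset.mem_union_left _ hu)
    have sub4 : ∀ u, u ∈ ({s, t} ∪ R : Finset V) → u ∈ W := fun u hu =>
      sub2 u (Finset.mem_union_right _ hu)
    have sub5 : ∀ u, u ∈ R → u ∈ W := fun u hu => (memR u hu).1
    have nA : ∀ u, u ∈ ({c, d} ∪ ({s, t} ∪ R) : Finset V) → ¬ (u = a ∨ u = b) := fun u hu h =>
      Finset.disjoint_left.1 d1 (by simpa using h) hu
    have nB1 : ∀ u, u ∈ ({s, t} ∪ R : Finset V) → ¬ (u = c ∨ u = d) := fun u hu h =>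
      Finset.disjoint_left.1 d2 (by simpa using h) hu
    have nB2 : ∀ u, u ∈ ({a, b} : Finset V) → ¬ (u = c ∨ u = d) := fun u hu h =>
      Finset.disjoint_left.1 d1 hu (Finset.mem_union_left _ (by simpa using h))
    have nC1 : ∀ u, u ∈ ({a, b} : Finset V) → ¬ (u = s ∨ u = t) := fun u hu h =>
      Finset.disjoint_left.1 d1 hu (Finset.mem_union_right _ (Finset.mem_union_left _
        (by simpa using h)))
    have nC2 : ∀ u, u ∈ ({c, d} : Finset V) → ¬ (u = s ∨ u = t) := fun u hu h =>
      Finset.disjoint_left.1 d2 hu (Finset.mem_union_left _ (by simpa using h))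
    have nC3 : ∀ u, u ∈ R → ¬ (u = s ∨ u = t) := fun u hu h =>
      Finset.disjoint_left.1 d3 (by simpa using h) hu
    have y1 : S3 (wt e x) {a, b} {a, b} {a, b} = 0 := by
      refine S3_zero _ _ _ _ fun u hu v hv z hz => wt_zero x fun h => ?_
      rcases mt c d h2 u (sub1 u hu) v (sub1 v hv) z (sub1 z hz) h with k | k | k
      exacts [nB2 u hu k, nB2 v hv k, nB2 z hz k]
    have y2 : S3 (wt e x) {a, b} {a, b} ({c, d} ∪ ({s, t} ∪ R)) = 0 := by
      rw [S3_union3 _ _ _ _ _ d2]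
      have y21 : S3 (wt e x) {a, b} {a, b} {c, d} = 0 := by
        refine S3_zero _ _ _ _ fun u hu v hv z hz => wt_zero x fun h => ?_
        rcases mt s t h3 u (sub1 u hu) v (sub1 v hv) z (sub3 z hz) h with k | k | k
        exacts [nC1 u hu k, nC1 v hv k, nC2 z hz k]
      have y22 : S3 (wt e x) {a, b} {a, b} ({s, t} ∪ R) = 0 := by
        refine S3_zero _ _ _ _ fun u hu v hv z hz => wt_zero x fun h => ?_
        rcases mt c d h2 u (sub1 u hu) v (sub1 v hv) z (sub4 z hz) h with k | k | k
        exacts [nB2 u hu k, nB2 v hv k, nB1 z hz k]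
      rw [y21, y22, add_zero]
    have y4 : S3 (wt e x) ({c, d} ∪ ({s, t} ∪ R)) ({c, d} ∪ ({s, t} ∪ R)) ({c, d} ∪ ({s, t} ∪ R))
        = 0 := by
      refine S3_zero _ _ _ _ fun u hu v hv z hz => wt_zero x fun h => ?_
      rcases mt a b h1 u (sub2 u hu) v (sub2 v hv) z (sub2 z hz) h with k | k | k
      exacts [nA u hu k, nA v hv k, nA z hz k]
    have y3 : S3 (wt e x) {a, b} ({c, d} ∪ ({s, t} ∪ R)) ({c, d} ∪ ({s, t} ∪ R))
        = 2 * S3 (wt e x) {a, b} {c, d} {s, t} := by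
      rw [S3_union2 _ _ _ _ _ d2, S3_union3 _ _ _ _ _ d2, S3_union3 _ _ _ _ _ d2]
      have y31 : S3 (wt e x) {a, b} {c, d} {c, d} = 0 := by
        refine S3_zero _ _ _ _ fun u hu v hv z hz => wt_zero x fun h => ?_
        rcases mt s t h3 u (sub1 u hu) v (sub3 v hv) z (sub3 z hz) h with k | k | k
        exacts [nC1 u hu k, nC2 v hv k, nC2 z hz k]
      have y34 : S3 (wt e x) {a, b} ({s, t} ∪ R) ({s, t} ∪ R) = 0 := by
        refine S3_zero _ _ _ _ fun u hu v hv z hz => wt_zero x fun h => ?_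
        rcases mt c d h2 u (sub1 u hu) v (sub4 v hv) z (sub4 z hz) h with k | k | k
        exacts [nB2 u hu k, nB1 v hv k, nB1 z hz k]
      have y32 : S3 (wt e x) {a, b} {c, d} R = 0 := by
        refine S3_zero _ _ _ _ fun u hu v hv z hz => wt_zero x fun h => ?_
        rcases mt s t h3 u (sub1 u hu) v (sub3 v hv) z (sub5 z hz) h with k | k | k
        exacts [nC1 u hu k, nC2 v hv k, nC3 z hz k]
      rw [S3_swap23 _ (wt_s2 he x) {a, b} ({s, t} ∪ R) {c, d}, S3_union3 _ _ _ _ _ d3, y31, y34, y32]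
      ring
    have hle := S3_le (e := e) hx {a, b} {c, d} {s, t}
    rw [sum_two hab, sum_two hcd, sum_two hst] at hle
    rw [hD, S3_split _ (wt_s1 he x) (wt_s2 he x) _ _ d1, y1, y2, y3, y4]
    linarith
  have fin := nu3 (x p) (x q) (x a) (x b) (x c) (x d) (x s) (x t) w (hx p) (hx q) (hx a) (hx b)
    (hx c) (hx d) (hx s) (hx t) hone hwle
  have hxpq : 0 ≤ x p + x q := add_nonneg (hx p) (hx q)
  have t2' := mul_le_mul_of_nonneg_left hsqle hxpq
  linarith


set_option maxHeartbeats 4000000 in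
theorem caseI2 [Fintype V] (e : V → V → V → Bool) (he : SymIrr e) (hm : Meets e) (x : V → ℝ)
    (hx : ∀ v, 0 ≤ x v) (hsum : ∑ v, x v = 1) (p q a b c d : V) (hpq : p ≠ q)
    (h1 : IsK4 e p q a b) (h2 : IsK4 e p q c d)
    (hn : [p, q, a, b, c, d].Nodup)
    (hno : ∀ s t, s ∉ ({p, q, a, b, c, d} : Finset V) → t ∉ ({p, q, a, b, c, d} : Finset V) →
      ¬ IsK4 e p q s t) :
    S3 (wt e x) univ univ univ ≤ 577/1000 := by
  obtain ⟨W, hW⟩ : ∃ W, W = ({p, q} : Finset V)ᶜ := ⟨_, rfl⟩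
  rw [S3_pair_split he x hpq W hW]
  have hU : (univ : Finset V) = {p, q} ∪ W := by rw [hW, Finset.union_compl]
  have hdis : Disjoint ({p, q} : Finset V) W := by rw [hW]; exact disjoint_compl_right
  have memW : ∀ u, u ∈ W ↔ u ≠ p ∧ u ≠ q := fun u => by rw [hW]; simp
  have mt : ∀ i j, IsK4 e p q i j → ∀ u ∈ W, ∀ v ∈ W, ∀ z ∈ W, e u v z = true →
      (u = i ∨ u = j) ∨ (v = i ∨ v = j) ∨ (z = i ∨ z = j) := by
    intro i j hK u hu v hv z hz h
    rw [memW] at hu hv hz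
    have := hm p q i j hK u v z h
    simp only [Finset.mem_insert, Finset.mem_singleton] at this
    tauto
  simp only [List.nodup_cons, List.mem_cons, List.not_mem_nil, or_false, not_or,
    not_false_eq_true, List.nodup_nil, and_true] at hn
  obtain ⟨⟨-, hpa, hpb, hpc, hpd⟩, ⟨hqa, hqb, hqc, hqd⟩,
    ⟨hab, hac, had⟩, ⟨hbc, hbd⟩, hcd⟩ := hn
  have wa : a ∈ W := (memW a).2 ⟨Ne.symm hpa, Ne.symm hqa⟩
  have wb : b ∈ W := (memW b).2 ⟨Ne.symm hpb, Ne.symm hqb⟩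
  have wc : c ∈ W := (memW c).2 ⟨Ne.symm hpc, Ne.symm hqc⟩
  have wd : d ∈ W := (memW d).2 ⟨Ne.symm hpd, Ne.symm hqd⟩
  obtain ⟨Z, hZ⟩ : ∃ Z, Z = ({a, b, c, d} : Finset V) := ⟨_, rfl⟩
  obtain ⟨R, hR⟩ : ∃ R, R = W \ Z := ⟨_, rfl⟩
  have hZW : Z ⊆ W := by
    rw [hZ]; intro u hu
    simp only [Finset.mem_insert, Finset.mem_singleton] at hu
    rcases hu with rfl | rfl | rfl | rfl <;> assumption
  have hD : W = Z ∪ R := by rw [hR, Finset.union_sdiff_of_subset hZW]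
  have hZR : Disjoint Z R := by rw [hR]; exact Finset.disjoint_sdiff
  have subR : ∀ u ∈ R, u ∈ W := fun u hu => by rw [hD]; exact Finset.mem_union_right _ hu
  have memR : ∀ u ∈ R, u ≠ a ∧ u ≠ b ∧ u ≠ c ∧ u ≠ d := by
    intro u hu
    have : u ∉ Z := fun h => Finset.disjoint_left.1 hZR h hu
    rw [hZ] at this
    simpa using this
  have hs4 := sum_four hab hac had hbc hbd hcd
  obtain ⟨P, hP⟩ : ∃ P, P = ∑ u ∈ R, x u * ind e p q u := ⟨_, rfl⟩
  obtain ⟨Q, hQ⟩ : ∃ Q, Q = ∑ u ∈ R, x u * (1 - ind e p q u) := ⟨_, rfl⟩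
  have hP0 : 0 ≤ P := by
    rw [hP]; exact Finset.sum_nonneg fun u _ => mul_nonneg (hx u) (ind_nonneg _ _ _ _)
  have hQ0 : 0 ≤ Q := by
    rw [hQ]
    exact Finset.sum_nonneg fun u _ => mul_nonneg (hx u) (sub_nonneg.2 (ind_le_one _ _ _ _))
  have hPQ : ∑ u ∈ R, x u = P + Q := by
    rw [hP, hQ, ← Finset.sum_add_distrib]
    exact Finset.sum_congr rfl fun u _ => by ring
  have hone : x p + x q + (x a + x b + x c + x d) + (P + Q) = 1 := by
    rw [← hsum, hU, Finset.sum_union hdis, sum_two hpq, hD, Finset.sum_union hZR, hPQ, hZ, hs4]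
    ring
  obtain ⟨m, hmm⟩ : ∃ m, m = min (x p) (x q) := ⟨_, rfl⟩
  have hmp : m ≤ x p := by rw [hmm]; exact min_le_left _ _
  have hmq : m ≤ x q := by rw [hmm]; exact min_le_right _ _
  have hm0 : 0 ≤ m := by rw [hmm]; exact le_min (hx p) (hx q)
  -- indicator of a missing complete subgraph
  have hG : ∃ G : V → V → ℝ, (∀ u v, G u v = 0 ∨ G u v = 1) ∧ (∀ u v, IsK4 e p q u v → G u v = 0) ∧
      (∀ u v, ¬ IsK4 e p q u v → G u v = 1) := by
    classical
    refine ⟨fun u v => if IsK4 e p q u v then 0 else 1, fun u v => ?_, fun u v h => ?_,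
      fun u v h => ?_⟩
    · by_cases h : IsK4 e p q u v
      · left; simp only [if_pos h]
      · right; simp only [if_neg h]
    · simp only [if_pos h]
    · simp only [if_neg h]
  obtain ⟨G, hG01, hG0, hG1⟩ := hG
  have hGn : ∀ u v, 0 ≤ G u v := fun u v => by rcases hG01 u v with h | h <;> rw [h] <;> norm_num
  -- pair bound
  have pb : ∀ u v, wt e x p u v + wt e x q u v ≤ (x p + x q) * (x u * x v)
      - m * (ind e p q u * ind e p q v * G u v) * (x u * x v) := by
    intro u v
    have hxx : 0 ≤ x u * x v := mul_nonneg (hx u) (hx v)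
    have key : x p * ind e p u v + x q * ind e q u v ≤ (x p + x q)
        - m * (ind e p q u * ind e p q v * G u v) := by
      have l1 := mul_le_mul_of_nonneg_left (ind_le_one e p u v) (hx p)
      have l2 := mul_le_mul_of_nonneg_left (ind_le_one e q u v) (hx q)
      by_cases k1 : e p q u = true
      · by_cases k2 : e p q v = true
        · rw [ind_eq_one k1, ind_eq_one k2]
          by_cases hK : IsK4 e p q u v
          · rw [hG0 u v hK]; linarith
          · rw [hG1 u v hK]
            by_cases k3 : e p u v = true
            · have k4 : ¬ e q u v = true := fun k4 => hK ⟨k1, k2, k3, k4⟩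
              rw [ind_eq_zero k4]; linarith
            · rw [ind_eq_zero k3]; linarith
        · rw [ind_eq_zero k2]; linarith
      · rw [ind_eq_zero k1]; linarith
    have := mul_le_mul_of_nonneg_right key hxx
    unfold wt
    linarith
  have z1 : ∀ i j, wt e x i j j = 0 := fun i j => by rw [wt_s1 he, wt_s2 he, wt_ir he]
  -- first sum
  have t1 : ∑ u ∈ W, wt e x p q u ≤ x p * x q * (x a + x b + x c + x d + P) := by
    rw [hD, Finset.sum_union hZR, hZ, hs4]
    have : ∑ u ∈ R, wt e x p q u = x p * x q * P := by
      rw [hP, Finset.mul_sum]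
      exact Finset.sum_congr rfl fun u _ => by unfold wt; ring
    rw [this]
    linarith [wt_le (e := e) hx p q a, wt_le (e := e) hx p q b, wt_le (e := e) hx p q c,
      wt_le (e := e) hx p q d]
  -- second sum
  have t2 : ∑ u ∈ W, ∑ v ∈ W, (wt e x p u v + wt e x q u v)
      ≤ (x p + x q) * ((x a + x b + x c + x d + P + Q)^2 - (x a^2 + x b^2 + x c^2 + x d^2))
        - 2 * m * (G a c * (x a * x c) + G a d * (x a * x d) + G b c * (x b * x c)
          + G b d * (x b * x d)) - m * P^2 := by
    have ia : ind e p q a = 1 := ind_eq_one h1.1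
    have ib : ind e p q b = 1 := ind_eq_one h1.2.1
    have ic : ind e p q c = 1 := ind_eq_one h2.1
    have id : ind e p q d = 1 := ind_eq_one h2.2.1
    have e1 : ∑ u ∈ W, ∑ v ∈ W, (wt e x p u v + wt e x q u v)
        = ∑ u ∈ Z, ∑ v ∈ Z, (wt e x p u v + wt e x q u v)
          + 2 * (∑ u ∈ Z, ∑ v ∈ R, (wt e x p u v + wt e x q u v))
          + ∑ u ∈ R, ∑ v ∈ R, (wt e x p u v + wt e x q u v) := by
      have sw : ∑ u ∈ R, ∑ v ∈ Z, (wt e x p u v + wt e x q u v)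
          = ∑ u ∈ Z, ∑ v ∈ R, (wt e x p u v + wt e x q u v) := by
        rw [Finset.sum_comm]
        exact Finset.sum_congr rfl fun u _ => Finset.sum_congr rfl fun v _ => by
          rw [wt_s2 he x p u v, wt_s2 he x q u v]
      rw [hD]
      simp only [Finset.sum_union hZR]
      simp only [Finset.sum_add_distrib] at sw ⊢
      linarith
    have e2 : ∑ u ∈ Z, ∑ v ∈ Z, (wt e x p u v + wt e x q u v)
        ≤ (x p + x q) * ((x a + x b + x c + x d)^2 - (x a^2 + x b^2 + x c^2 + x d^2))
        - 2 * m * (G a c * (x a * x c) + G a d * (x a * x d) + G b c * (x b * x c)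
          + G b d * (x b * x d)) := by
      rw [hZ, pair_sum_four hab hac had hbc hbd hcd (fun u v => wt e x p u v + wt e x q u v)
        (fun i j => by rw [wt_s2 he x p i j, wt_s2 he x q i j])
        (fun i => by simp only [z1]; norm_num)]
      have pab := pb a b
      have pac := pb a c
      have pad := pb a d
      have pbc := pb b c
      have pbd := pb b d
      have pcd := pb c d
      rw [ia, ib, hG0 a b h1] at pab
      rw [ic, id, hG0 c d h2] at pcd
      rw [ia, ic] at pac
      rw [ia, id] at pad
      rw [ib, ic] at pbc
      rw [ib, id] at pbd
      linarith
    have e3 : ∑ u ∈ Z, ∑ v ∈ R, (wt e x p u v + wt e x q u v)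
        ≤ (x p + x q) * ((x a + x b + x c + x d) * (P + Q)) := by
      have : (x p + x q) * ((x a + x b + x c + x d) * (P + Q))
          = ∑ u ∈ Z, ∑ v ∈ R, (x p + x q) * (x u * x v) := by
        simp only [← Finset.mul_sum, ← Finset.sum_mul]
        rw [hPQ, hZ, hs4]
      rw [this]
      refine Finset.sum_le_sum fun u _ => Finset.sum_le_sum fun v _ => ?_
      linarith [wt_le (e := e) hx p u v, wt_le (e := e) hx q u v]
    have e4 : ∑ u ∈ R, ∑ v ∈ R, (wt e x p u v + wt e x q u v)
        ≤ (x p + x q) * (P + Q)^2 - m * P^2 := by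
      have : (x p + x q) * (P + Q)^2 - m * P^2
          = ∑ u ∈ R, ∑ v ∈ R, ((x p + x q) * (x u * x v)
            - m * ((x u * ind e p q u) * (x v * ind e p q v))) := by
        simp only [Finset.sum_sub_distrib, ← Finset.mul_sum, ← Finset.sum_mul]
        rw [hPQ, ← hP]; ring
      rw [this]
      refine Finset.sum_le_sum fun u hu => Finset.sum_le_sum fun v hv => ?_
      have hK : ¬ IsK4 e p q u v := by
        have a1 := memR u hu
        have a2 := memR v hv
        have a3 := (memW u).1 (subR u hu)
        have a4 := (memW v).1 (subR v hv)
        exact hno u v (by simp only [Finset.mem_insert, Finset.mem_singleton]; tauto)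
          (by simp only [Finset.mem_insert, Finset.mem_singleton]; tauto)
      have := pb u v
      rw [hG1 u v hK] at this
      linarith
    rw [e1]
    linarith
  -- third sum
  have t3 : S3 (wt e x) W W W ≤ 6 * (x a * x b * x c + x a * x b * x d + x a * x c * x d
      + x b * x c * x d) + 6 * ((P + Q) * (G b d * (x a * x c) + G b c * (x a * x d)
      + G a d * (x b * x c) + G a c * (x b * x d))) := by
    have y1 : S3 (wt e x) Z Z Z ≤ 6 * (x a * x b * x c + x a * x b * x d + x a * x c * x d
        + x b * x c * x d) := by
      rw [hZ, S3_four hab hac had hbc hbd hcd _ (wt_s1 he x) (wt_s2 he x) (wt_ir he x)]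
      linarith [wt_le (e := e) hx a b c, wt_le (e := e) hx a b d, wt_le (e := e) hx a c d,
        wt_le (e := e) hx b c d]
    have y3 : S3 (wt e x) Z R R = 0 := by
      refine S3_zero _ _ _ _ fun u hu v hv z hz => wt_zero x fun h => ?_
      have k1 := mt a b h1 u (hZW hu) v (subR v hv) z (subR z hz) h
      have k2 := mt c d h2 u (hZW hu) v (subR v hv) z (subR z hz) h
      have a1 := memR v hv
      have a2 := memR z hz
      have k1' : u = a ∨ u = b := by tauto
      have k2' : u = c ∨ u = d := by tauto
      rcases k1' with rfl | rfl <;> tauto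
    have y4 : S3 (wt e x) R R R = 0 := by
      refine S3_zero _ _ _ _ fun u hu v hv z hz => wt_zero x fun h => ?_
      have k1 := mt a b h1 u (subR u hu) v (subR v hv) z (subR z hz) h
      have a0 := memR u hu
      have a1 := memR v hv
      have a2 := memR z hz
      tauto
    have y2 : S3 (wt e x) Z Z R ≤ 2 * ((P + Q) * (G b d * (x a * x c) + G b c * (x a * x d)
      + G a d * (x b * x c) + G a c * (x b * x d))) := by
      rw [S3_swap23 _ (wt_s2 he x) Z Z R, S3_swap12 _ (wt_s1 he x) Z R Z]
      unfold S3
      rw [← hPQ, Finset.sum_mul, Finset.mul_sum]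
      refine Finset.sum_le_sum fun u hu => ?_
      rw [hZ, pair_sum_four hab hac had hbc hbd hcd (fun i j => wt e x u i j)
        (fun i j => wt_s2 he x u i j) (fun i => z1 u i)]
      have a0 := memR u hu
      have wu := subR u hu
      have zab : wt e x u a b = 0 := by
        refine wt_zero x fun h => ?_
        have := mt c d h2 u wu a wa b wb h
        tauto
      have zcd : wt e x u c d = 0 := by
        refine wt_zero x fun h => ?_
        have := mt a b h1 u wu c wc d wd h
        rcases this with h | (h | h) | (h | h)
        · tauto
        · exact hac h.symm
        · exact hbc h.symm
        · exact had h.symm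
        · exact hbd h.symm
      have cr : ∀ i j k l, i ∈ W → j ∈ W → u ≠ k → u ≠ l → i ≠ k → i ≠ l → j ≠ k → j ≠ l →
          wt e x u i j ≤ x u * (G k l * (x i * x j)) := by
        intro i j k l wi wj n1 n2 n3 n4 n5 n6
        by_cases hK : IsK4 e p q k l
        · rw [hG0 k l hK, wt_zero x (fun h => ?_)]
          · simp
          · have := mt k l hK u wu i wi j wj h
            tauto
        · rw [hG1 k l hK]
          linarith [wt_le (e := e) hx u i j]
      have c1 := cr a c b d wa wc a0.2.1 a0.2.2.2 hab had (Ne.symm hbc) hcd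
      have c2 := cr a d b c wa wd a0.2.1 a0.2.2.1 hab hac (Ne.symm hbd) (Ne.symm hcd)
      have c3 := cr b c a d wb wc a0.1 a0.2.2.2 (Ne.symm hab) hbd (Ne.symm hac) hcd
      have c4 := cr b d a c wb wd a0.1 a0.2.2.1 (Ne.symm hab) hbc (Ne.symm had) (Ne.symm hcd)
      rw [zab, zcd]
      linarith
    rw [hD, S3_split _ (wt_s1 he x) (wt_s2 he x) _ _ hZR, y3, y4]
    linarith
  have fin := nu2_all (x p) (x q) m (x a) (x b) (x c) (x d) P Q (G b d) (G b c) (G a d) (G a c)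
    (hx p) (hx q) hmm (hx a) (hx b) (hx c) (hx d) hP0 hQ0 hone (hG01 _ _) (hG01 _ _) (hG01 _ _)
    (hG01 _ _)
  linarith

theorem caseI [Fintype V] (e : V → V → V → Bool) (he : SymIrr e) (hm : Meets e) (x : V → ℝ)
    (hx : ∀ v, 0 ≤ x v) (hsum : ∑ v, x v = 1) (p q a b c d : V)
    (h1 : IsK4 e p q a b) (h2 : IsK4 e p q c d)
    (hn : [p, q, a, b, c, d].Nodup) :
    S3 (wt e x) univ univ univ ≤ Real.sqrt 3 / 3 := by
  have hpq : p ≠ q := by rintro rfl; simp at hn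
  by_cases h : ∃ s t, s ∉ ({p, q, a, b, c, d} : Finset V) ∧ t ∉ ({p, q, a, b, c, d} : Finset V) ∧
      IsK4 e p q s t
  · obtain ⟨s, t, hs, ht, hK⟩ := h
    have hst : s ≠ t := by
      rintro rfl
      have := hK.2.2.1
      rw [he.s1, he.s2, he.ir] at this
      exact Bool.false_ne_true this
    refine caseI3 e he hm x hx hsum p q a b c d s t hpq h1 h2 hK ?_
    simp only [List.nodup_cons, List.mem_cons, List.not_mem_nil, or_false, not_or,
      not_false_eq_true, List.nodup_nil, and_true, Finset.mem_insert, Finset.mem_singleton]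
      at hn hs ht ⊢
    grind
  · push Not at h
    exact (caseI2 e he hm x hx hsum p q a b c d hpq h1 h2 hn h).trans c577

theorem isK4_ne {e : V → V → V → Bool} (he : SymIrr e) {a b c d : V} (h : IsK4 e a b c d) :
    a ≠ b ∧ a ≠ c ∧ a ≠ d ∧ b ≠ c ∧ b ≠ d ∧ c ≠ d := by
  obtain ⟨h1, h2, h3, h4⟩ := h
  have z1 : ∀ i j, e i j j = false := fun i j => by rw [he.s1, he.s2, he.ir]
  have z2 : ∀ i j, e i j i = false := fun i j => by rw [he.s2, he.ir]
  have z3 := he.ir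
  refine ⟨?_, ?_, ?_, ?_, ?_, ?_⟩ <;> rintro rfl <;> simp_all

/-- the upper bound in abstract form -/
theorem abstract_upper [Fintype V] (e : V → V → V → Bool) (he : SymIrr e) (hm : Meets e)
    (x : V → ℝ) (hx : ∀ v, 0 ≤ x v) (hsum : ∑ v, x v = 1) :
    S3 (wt e x) univ univ univ ≤ Real.sqrt 3 / 3 := by
  by_cases hK : ∃ a b c d, IsK4 e a b c d
  · obtain ⟨a, b, c, d, hK⟩ := hK
    obtain ⟨hab, hac, had, hbc, hbd, hcd⟩ := isK4_ne he hK
    by_cases hno : ∀ i ∈ ({a, b, c, d} : Finset V), ∀ j ∈ ({a, b, c, d} : Finset V), i ≠ j →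
      ∀ u v, u ∉ ({a, b, c, d} : Finset V) → v ∉ ({a, b, c, d} : Finset V) → ¬ IsK4 e u v i j
    · exact (caseII e he hm x hx hsum a b c d hK hab hac had hbc hbd hcd hno).trans c577
    · push Not at hno
      obtain ⟨i, hi, j, hj, hij, u, v, hu, hv, hK2⟩ := hno
      have huv : u ≠ v := (isK4_ne he hK2).1
      have s1 := he.s1
      have s2 := he.s2
      have hK3 : IsK4 e i j u v := by
        obtain ⟨k1, k2, k3, k4⟩ := hK2
        refine ⟨?_, ?_, ?_, ?_⟩
        · rw [s2, s1, ← k3, s2 u i j, s1 u j i, s2 j u i, s1 j i u, s2 i j u, s1 i u j]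
        · rw [s2, s1, ← k4, s2 v i j, s1 v j i, s2 j v i, s1 j i v, s2 i j v, s1 i v j]
        · rw [s1, s2, ← k1]
        · rw [s1, s2, ← k2]
      obtain ⟨k1, k2, k3, k4⟩ := hK
      have hex : ∃ k l, IsK4 e i j k l ∧ [i, j, k, l, u, v].Nodup := by
        simp only [Finset.mem_insert, Finset.mem_singleton, not_or] at hi hj hu hv
        have fin : ∀ k l, IsK4 e i j k l → (k = a ∨ k = b ∨ k = c ∨ k = d) →
            (l = a ∨ l = b ∨ l = c ∨ l = d) → ∃ k l, IsK4 e i j k l ∧ [i, j, k, l, u, v].Nodup := by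
          intro k l hk h1 h2
          refine ⟨k, l, hk, ?_⟩
          have := isK4_ne he hk
          simp only [List.nodup_cons, List.mem_cons, List.not_mem_nil, or_false, not_or,
            not_false_eq_true, List.nodup_nil, and_true]
          grind
        have rot : ∀ a b c, e a b c = true → e a c b = true ∧ e b a c = true ∧ e b c a = true ∧
            e c a b = true ∧ e c b a = true := by
          intro a b c h
          have q1 : e a c b = true := by rw [← s2]; exact h
          have q2 : e b a c = true := by rw [← s1]; exact h
          have q3 : e b c a = true := by rw [← s2]; exact q2
          have q4 : e c a b = true := by rw [← s1]; exact q1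
          have q5 : e c b a = true := by rw [← s2]; exact q4
          exact ⟨q1, q2, q3, q4, q5⟩
        obtain ⟨r11, r12, r13, r14, r15⟩ := rot _ _ _ k1
        obtain ⟨r21, r22, r23, r24, r25⟩ := rot _ _ _ k2
        obtain ⟨r31, r32, r33, r34, r35⟩ := rot _ _ _ k3
        obtain ⟨r41, r42, r43, r44, r45⟩ := rot _ _ _ k4
        rcases hi with rfl | rfl | rfl | rfl <;> rcases hj with rfl | rfl | rfl | rfl
        · exact absurd rfl hij
        · exact fin c d ⟨by assumption, by assumption, by assumption, by assumption⟩ (by simp) (by simp)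
        · exact fin b d ⟨by assumption, by assumption, by assumption, by assumption⟩ (by simp) (by simp)
        · exact fin b c ⟨by assumption, by assumption, by assumption, by assumption⟩ (by simp) (by simp)
        · exact fin c d ⟨by assumption, by assumption, by assumption, by assumption⟩ (by simp) (by simp)
        · exact absurd rfl hij
        · exact fin a d ⟨by assumption, by assumption, by assumption, by assumption⟩ (by simp) (by simp)
        · exact fin a c ⟨by assumption, by assumption, by assumption, by assumption⟩ (by simp) (by simp)
        · exact fin b d ⟨by assumption, by assumption, by assumption, by assumption⟩ (by simp) (by simp)
        · exact fin a d ⟨by assumption, by assumption, by assumption, by assumption⟩ (by simp) (by simp)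
        · exact absurd rfl hij
        · exact fin a b ⟨by assumption, by assumption, by assumption, by assumption⟩ (by simp) (by simp)
        · exact fin b c ⟨by assumption, by assumption, by assumption, by assumption⟩ (by simp) (by simp)
        · exact fin a c ⟨by assumption, by assumption, by assumption, by assumption⟩ (by simp) (by simp)
        · exact fin a b ⟨by assumption, by assumption, by assumption, by assumption⟩ (by simp) (by simp)
        · exact absurd rfl hij
      obtain ⟨k, l, hkl, hnd⟩ := hex
      exact caseI e he hm x hx hsum i j k l u v hkl hK3 hnd
  · push Not at hK
    exact (k4free_bound e x hx hsum he.s1 he.s2 hK).trans c577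

end partB


section partC

/-- ordered-triple weight of a hypergraph -/
noncomputable def tw (G : ThreeGraph) (w : ℕ → ℝ) (a b c : ℕ) : ℝ :=
  w a * w b * w c * (if ({a, b, c} : Finset ℕ) ∈ G.edges then 1 else 0)

theorem edge_six (V s : Finset ℕ) (hs : s ⊆ V) (hc : s.card = 3) (w : ℕ → ℝ) :
    ∑ a ∈ V, ∑ b ∈ V, ∑ c ∈ V, w a * w b * w c * (if ({a, b, c} : Finset ℕ) = s then 1 else 0)
      = 6 * ∏ v ∈ s, w v := by
  have h0 : ∀ a b c, (a ∉ s ∨ b ∉ s ∨ c ∉ s) →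
      w a * w b * w c * (if ({a, b, c} : Finset ℕ) = s then (1 : ℝ) else 0) = 0 := by
    intro a b c h
    rw [if_neg, mul_zero]
    rintro rfl
    simp at h
  have h1 : ∑ a ∈ V, ∑ b ∈ V, ∑ c ∈ V,
      w a * w b * w c * (if ({a, b, c} : Finset ℕ) = s then (1 : ℝ) else 0)
      = ∑ a ∈ s, ∑ b ∈ s, ∑ c ∈ s,
      w a * w b * w c * (if a ≠ b ∧ a ≠ c ∧ b ≠ c then (1 : ℝ) else 0) := by
    rw [← Finset.sum_subset hs]
    · refine Finset.sum_congr rfl fun a ha => ?_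
      rw [← Finset.sum_subset hs]
      · refine Finset.sum_congr rfl fun b hb => ?_
        rw [← Finset.sum_subset hs]
        · refine Finset.sum_congr rfl fun c hcc => ?_
          congr 1
          refine if_congr ?_ rfl rfl
          constructor
          · intro h
            rw [← h] at hc
            exact Finset.card_eq_three.1 hc |> fun _ => by
              refine ⟨?_, ?_, ?_⟩
              · rintro rfl
                have := Finset.card_le_two (a := a) (b := c)
                simp at hc; omega
              · rintro rfl
                have := Finset.card_le_two (a := b) (b := a)
                rw [Finset.insert_comm] at hc
                simp at hc; omega
              · rintro rfl
                have := Finset.card_le_two (a := a) (b := b)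
                simp at hc; omega
          · rintro ⟨p, q, r⟩
            refine Finset.eq_of_subset_of_card_le ?_ ?_
            · intro z hz
              simp at hz
              rcases hz with rfl | rfl | rfl <;> assumption
            · rw [hc, Finset.card_eq_three.2 ⟨a, b, c, p, q, r, rfl⟩]
        · intro c _ h; exact h0 _ _ _ (Or.inr (Or.inr h))
      · intro b _ h; exact Finset.sum_eq_zero fun c _ => h0 _ _ _ (Or.inr (Or.inl h))
    · intro a _ h
      exact Finset.sum_eq_zero fun b _ => Finset.sum_eq_zero fun c _ => h0 _ _ _ (Or.inl h)
  rw [h1]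
  obtain ⟨p, q, r, hpq, hpr, hqr, rfl⟩ := Finset.card_eq_three.1 hc
  have h3 : ∀ g : ℕ → ℝ, ∑ i ∈ ({p, q, r} : Finset ℕ), g i = g p + (g q + g r) := fun g => by
    rw [Finset.sum_insert (by simp [hpq, hpr]), Finset.sum_pair hqr]
  have h4 : ∏ i ∈ ({p, q, r} : Finset ℕ), w i = w p * (w q * w r) := by
    rw [Finset.prod_insert (by simp [hpq, hpr]), Finset.prod_pair hqr]
  rw [h4]
  simp only [h3]
  simp [hpq, hpr, hqr, hpq.symm, hpr.symm, hqr.symm]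
  ring

theorem six_lagFun (G : ThreeGraph) (w : ℕ → ℝ) :
    6 * G.lagFun w = S3 (tw G w) G.verts G.verts G.verts := by
  unfold HyperGraph.lagFun S3
  rw [Finset.mul_sum]
  rw [Finset.sum_congr rfl fun s hs => (edge_six G.verts s (G.edges_sub s hs) (G.card_eq s hs) w).symm]
  rw [Finset.sum_comm]
  refine Finset.sum_congr rfl fun a _ => ?_
  rw [Finset.sum_comm]
  refine Finset.sum_congr rfl fun b _ => ?_
  rw [Finset.sum_comm]
  refine Finset.sum_congr rfl fun c _ => ?_
  rw [← Finset.mul_sum, Finset.sum_ite_eq]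
  rfl

theorem edge_ne (G : ThreeGraph) {a b c : ℕ} (h : ({a, b, c} : Finset ℕ) ∈ G.edges) :
    a ≠ b ∧ a ≠ c ∧ b ≠ c := by
  have hc := G.card_eq _ h
  refine ⟨?_, ?_, ?_⟩
  · rintro rfl
    have := Finset.card_le_two (a := a) (b := c)
    simp at hc; omega
  · rintro rfl
    have := Finset.card_le_two (a := b) (b := a)
    rw [Finset.insert_comm] at hc
    simp at hc; omega
  · rintro rfl
    have := Finset.card_le_two (a := a) (b := b)
    simp at hc; omega

set_option maxHeartbeats 4000000 in
theorem lagFun_upper (G : ThreeGraph) (hG : G.Free K43e) (w : ℕ → ℝ) (hw : G.IsFeasible w) :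
    6 * G.lagFun w ≤ Real.sqrt 3 / 3 := by
  obtain ⟨hw0, hw1⟩ := hw
  let e : G.verts → G.verts → G.verts → Bool :=
    fun a b c => decide (({a.1, b.1, c.1} : Finset ℕ) ∈ G.edges)
  have he : SymIrr e := by
    refine ⟨fun a b c => ?_, fun a b c => ?_, fun a b => ?_⟩
    · simp only [e, Finset.insert_comm]
    · simp only [e, Finset.pair_comm]
    · simp only [e, decide_eq_false_iff_not]
      intro h
      exact (edge_ne G h).1 rfl
  have hm : Meets e := by
    intro a b c d hK u v z huv
    by_contra hcon
    obtain ⟨nab, nac, nad, nbc, nbd, ncd⟩ := isK4_ne he hK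
    obtain ⟨h1, h2, h3, h4⟩ := hK
    simp only [e, decide_eq_true_eq] at h1 h2 h3 h4 huv
    obtain ⟨nuv, nuz, nvz⟩ := edge_ne G huv
    simp only [Finset.mem_insert, Finset.mem_singleton, not_or, Subtype.ext_iff] at hcon
    simp only [ne_eq, Subtype.ext_iff] at nab nac nad nbc nbd ncd
    obtain ⟨a, ha⟩ := a
    obtain ⟨b, hb⟩ := b
    obtain ⟨c, hc⟩ := c
    obtain ⟨d, hd⟩ := d
    obtain ⟨u, hu⟩ := u
    obtain ⟨v, hv⟩ := v
    obtain ⟨z, hz⟩ := z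
    dsimp only at nab nac nad nbc nbd ncd hcon nuv nuz nvz h1 h2 h3 h4 huv
    obtain ⟨⟨u1, u2, u3, u4⟩, ⟨v1, v2, v3, v4⟩, z1, z2, z3, z4⟩ := hcon
    apply hG
    refine ⟨fun i => if i = 1 then a else if i = 2 then b else if i = 3 then c else
      if i = 4 then d else if i = 5 then u else if i = 6 then v else z, ?_, ?_, ?_⟩
    · intro i hi j hj hij
      simp only [K43e, Finset.coe_insert, Finset.coe_singleton, Set.mem_insert_iff,
        Set.mem_singleton_iff] at hi hj
      rcases hi with rfl | rfl | rfl | rfl | rfl | rfl | rfl <;>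
      rcases hj with rfl | rfl | rfl | rfl | rfl | rfl | rfl <;>
      first
        | rfl
        | (exfalso
           simp [nab, nac, nad, nbc, nbd, ncd, nuv, nuz, nvz, u1, u2, u3, u4, v1, v2, v3, v4,
            z1, z2, z3, z4, Ne.symm nab, Ne.symm nac, Ne.symm nad, Ne.symm nbc, Ne.symm nbd,
            Ne.symm ncd, Ne.symm nuv, Ne.symm nuz, Ne.symm nvz, Ne.symm u1, Ne.symm u2,
            Ne.symm u3, Ne.symm u4, Ne.symm v1, Ne.symm v2, Ne.symm v3, Ne.symm v4,
            Ne.symm z1, Ne.symm z2, Ne.symm z3, Ne.symm z4] at hij)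
    · intro i hi
      dsimp only
      split_ifs <;> assumption
    · intro s hs
      simp only [K43e, Finset.mem_insert, Finset.mem_singleton] at hs
      rcases hs with rfl | rfl | rfl | rfl | rfl <;> simpa [Finset.image_insert]
  have key := abstract_upper e he hm (fun v => w v.1) (fun v => hw0 v.1 v.2)
    (by rw [← hw1]; exact Finset.sum_coe_sort G.verts w)
  refine le_trans (le_of_eq ?_) key
  rw [six_lagFun]
  unfold S3
  rw [← Finset.sum_coe_sort G.verts]
  refine Finset.sum_congr rfl fun a _ => ?_
  rw [← Finset.sum_coe_sort G.verts]
  refine Finset.sum_congr rfl fun b _ => ?_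
  rw [← Finset.sum_coe_sort G.verts]
  refine Finset.sum_congr rfl fun c _ => ?_
  simp [tw, wt, ind, e]

theorem lag_upper (G : ThreeGraph) (hG : G.Free K43e) : 6 * G.lag ≤ Real.sqrt 3 / 3 := by
  have : G.lag ≤ Real.sqrt 3 / 3 / 6 := by
    refine Real.sSup_le ?_ (by positivity)
    rintro x ⟨w, hw, rfl⟩
    have := lagFun_upper G hG w hw
    linarith
  linarith

theorem lag_ge (G : ThreeGraph) (hG : G.Free K43e) (w : ℕ → ℝ) (hw : G.IsFeasible w) :
    G.lagFun w ≤ G.lag := by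
  refine le_csSup ⟨Real.sqrt 3 / 3 / 6, ?_⟩ ⟨w, hw, rfl⟩
  rintro x ⟨w, hw, rfl⟩
  have := lagFun_upper G hG w hw
  linarith

/-- the extremal construction -/
def extG (n : ℕ) : ThreeGraph where
  verts := {0, 1} ∪ Finset.Ico 2 (n + 2)
  edges := (({0, 1} ∪ Finset.Ico 2 (n + 2)).powersetCard 3).filter fun s => 0 ∈ s ∨ 1 ∈ s
  edges_sub := by
    intro e he
    exact (Finset.mem_powersetCard.1 (Finset.mem_filter.1 he).1).1
  card_eq := by
    intro e he
    exact (Finset.mem_powersetCard.1 (Finset.mem_filter.1 he).1).2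

theorem has_val (x y p q r s : ℕ) (n12 : p ≠ q) (n13 : p ≠ r) (n14 : p ≠ s) (n23 : q ≠ r)
    (n24 : q ≠ s) (n34 : r ≠ s)
    (k1 : (p = x ∨ q = x ∨ r = x) ∨ p = y ∨ q = y ∨ r = y)
    (k2 : (p = x ∨ q = x ∨ s = x) ∨ p = y ∨ q = y ∨ s = y)
    (k3 : (p = x ∨ r = x ∨ s = x) ∨ p = y ∨ r = y ∨ s = y)
    (k4 : (q = x ∨ r = x ∨ s = x) ∨ q = y ∨ r = y ∨ s = y) :
    p = x ∨ q = x ∨ r = x ∨ s = x := by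
  by_contra h
  simp only [not_or] at h
  obtain ⟨a, b, c, d⟩ := h
  simp only [a, b, c, d, or_self, false_or] at k1 k2 k3 k4
  rcases k1 with rfl | rfl | rfl
  · rcases k4 with h | h | h
    · exact n12 h.symm
    · exact n13 h.symm
    · exact n14 h.symm
  · rcases k3 with h | h | h
    · exact n12 h
    · exact n23 h.symm
    · exact n24 h.symm
  · rcases k2 with h | h | h
    · exact n13 h
    · exact n23 h
    · exact n34 h.symm

theorem extG_free (n : ℕ) : (extG n).Free K43e := by
  rintro ⟨f, hinj, hv, he⟩
  have key : ∀ s ∈ K43e.edges, 0 ∈ s.image f ∨ 1 ∈ s.image f := fun s hs =>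
    (Finset.mem_filter.1 (he s hs)).2
  have k1 := key {1, 2, 3} (by decide)
  have k2 := key {1, 2, 4} (by decide)
  have k3 := key {1, 3, 4} (by decide)
  have k4 := key {2, 3, 4} (by decide)
  have k5 := key {5, 6, 7} (by decide)
  have ne : ∀ i ∈ K43e.verts, ∀ j ∈ K43e.verts, i ≠ j → f i ≠ f j :=
    fun i hi j hj hij h => hij (hinj hi hj h)
  have n12 := ne 1 (by decide) 2 (by decide) (by decide)
  have n13 := ne 1 (by decide) 3 (by decide) (by decide)
  have n14 := ne 1 (by decide) 4 (by decide) (by decide)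
  have n23 := ne 2 (by decide) 3 (by decide) (by decide)
  have n24 := ne 2 (by decide) 4 (by decide) (by decide)
  have n34 := ne 3 (by decide) 4 (by decide) (by decide)
  have m : ∀ i ∈ ({1, 2, 3, 4} : Finset ℕ), ∀ j ∈ ({5, 6, 7} : Finset ℕ), f i ≠ f j := by
    intro i hi j hj
    refine ne i ?_ j ?_ ?_
    · revert i; decide
    · revert j; decide
    · rintro rfl; revert hj; revert i; decide
  simp only [Finset.mem_insert, Finset.mem_singleton, forall_eq_or_imp, forall_eq] at m
  simp only [Finset.mem_image, Finset.mem_insert, Finset.mem_singleton, exists_eq_or_imp,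
    exists_eq_left] at k1 k2 k3 k4 k5
  have z0 := has_val 0 1 _ _ _ _ n12 n13 n14 n23 n24 n34 k1 k2 k3 k4
  have z1 := has_val 1 0 _ _ _ _ n12 n13 n14 n23 n24 n34 k1.symm k2.symm k3.symm k4.symm
  clear k1 k2 k3 k4 n12 n13 n14 n23 n24 n34 ne key he hinj hv
  obtain ⟨⟨a1, a2, a3⟩, ⟨b1, b2, b3⟩, ⟨c1, c2, c3⟩, d1, d2, d3⟩ := m
  rcases k5 with (h | h | h) | h | h | h
  all_goals first
    | (rcases z0 with g | g | g | g <;> exact absurd (g.trans h.symm) (by assumption))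
    | (rcases z1 with g | g | g | g <;> exact absurd (g.trans h.symm) (by assumption))

theorem ext_tw (n : ℕ) (w : ℕ → ℝ) (a b c : ℕ) (ha : a ∈ (extG n).verts) (hb : b ∈ (extG n).verts)
    (hc : c ∈ (extG n).verts) : tw (extG n) w a b c =
    if a ≠ b ∧ a ≠ c ∧ b ≠ c ∧ (a < 2 ∨ b < 2 ∨ c < 2) then w a * w b * w c else 0 := by
  unfold tw
  by_cases h : a ≠ b ∧ a ≠ c ∧ b ≠ c ∧ (a < 2 ∨ b < 2 ∨ c < 2)
  · rw [if_pos h, if_pos, mul_one]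
    refine Finset.mem_filter.2 ⟨Finset.mem_powersetCard.2 ⟨?_, ?_⟩, ?_⟩
    · intro z hz
      simp only [Finset.mem_insert, Finset.mem_singleton] at hz
      rcases hz with rfl | rfl | rfl
      · exact ha
      · exact hb
      · exact hc
    · exact Finset.card_eq_three.2 ⟨a, b, c, h.1, h.2.1, h.2.2.1, rfl⟩
    · simp only [Finset.mem_insert, Finset.mem_singleton]
      omega
  · rw [if_neg h, if_neg, mul_zero]
    intro hE
    have h1 := edge_ne _ hE
    have h2 := (Finset.mem_filter.1 hE).2
    simp only [Finset.mem_insert, Finset.mem_singleton] at h2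
    omega

theorem ext_value (n : ℕ) (y t : ℝ) :
    6 * (extG n).lagFun (fun v => if v < 2 then y else t)
      = 6 * y ^ 2 * (n * t) + 6 * y * t ^ 2 * ((n : ℝ) ^ 2 - n) := by
  rw [six_lagFun]
  set w : ℕ → ℝ := fun v => if v < 2 then y else t with hw
  have hdis : Disjoint ({0, 1} : Finset ℕ) (Finset.Ico 2 (n + 2)) := by
    rw [Finset.disjoint_left]
    intro a ha hb
    simp at ha hb
    omega
  have s1 : ∀ a b c, tw (extG n) w a b c = tw (extG n) w b a c := by
    intro a b c
    unfold tw
    rw [Finset.insert_comm]; ring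
  have s2 : ∀ a b c, tw (extG n) w a b c = tw (extG n) w a c b := by
    intro a b c
    unfold tw
    rw [Finset.pair_comm]; ring
  have w0 : w 0 = y := rfl
  have w1 : w 1 = y := rfl
  have wB : ∀ c, ¬ c < 2 → w c = t := fun c hc => if_neg hc
  have mB : ∀ c ∈ Finset.Ico 2 (n + 2), c ∈ (extG n).verts := fun c hc =>
    Finset.mem_union_right _ hc
  have m0 : 0 ∈ (extG n).verts := Finset.mem_union_left _ (by simp)
  have m1 : 1 ∈ (extG n).verts := Finset.mem_union_left _ (by simp)
  have hA : ∀ g : ℕ → ℝ, ∑ i ∈ ({0, 1} : Finset ℕ), g i = g 0 + g 1 := fun g =>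
    Finset.sum_pair (by decide)
  have hv : (extG n).verts = {0, 1} ∪ Finset.Ico 2 (n + 2) := rfl
  have e1 : S3 (tw (extG n) w) {0, 1} {0, 1} {0, 1} = 0 := by
    unfold S3
    simp only [hA]
    simp [ext_tw, m0, m1]
  have e2 : S3 (tw (extG n) w) {0, 1} {0, 1} (Finset.Ico 2 (n + 2)) = 2 * y ^ 2 * (n * t) := by
    have : ∀ c ∈ Finset.Ico 2 (n + 2), tw (extG n) w 0 0 c = 0 ∧ tw (extG n) w 1 1 c = 0 ∧
        tw (extG n) w 0 1 c = y ^ 2 * t ∧ tw (extG n) w 1 0 c = y ^ 2 * t := by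
      intro c hc
      have hc2 : ¬ c < 2 := by simp at hc; omega
      have c0 : (0 : ℕ) ≠ c := by omega
      have c1 : (1 : ℕ) ≠ c := by omega
      refine ⟨?_, ?_, ?_, ?_⟩ <;> rw [ext_tw n w _ _ _ (by assumption) (by assumption) (mB c hc)] <;>
        simp [-mul_eq_mul_right_iff, -mul_eq_mul_left_iff, w0, w1, wB c hc2, c0, c1] <;> ring
    unfold S3
    simp only [hA]
    rw [Finset.sum_congr rfl fun c hc => (this c hc).1,
      Finset.sum_congr rfl fun c hc => (this c hc).2.1,
      Finset.sum_congr rfl fun c hc => (this c hc).2.2.1,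
      Finset.sum_congr rfl fun c hc => (this c hc).2.2.2]
    simp
    ring
  have e3 : S3 (tw (extG n) w) {0, 1} (Finset.Ico 2 (n + 2)) (Finset.Ico 2 (n + 2))
      = 2 * y * t ^ 2 * ((n : ℝ) ^ 2 - n) := by
    have : ∀ b ∈ Finset.Ico 2 (n + 2), ∀ c ∈ Finset.Ico 2 (n + 2),
        tw (extG n) w 0 b c = y * t ^ 2 - (if b = c then y * t ^ 2 else 0) ∧
        tw (extG n) w 1 b c = y * t ^ 2 - (if b = c then y * t ^ 2 else 0) := by
      intro b hb c hc
      have hc2 : ¬ c < 2 := by simp at hc; omega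
      have c0 : (0 : ℕ) ≠ c := by omega
      have c1 : (1 : ℕ) ≠ c := by omega
      have hb2 : ¬ b < 2 := by simp at hb; omega
      have b0 : (0 : ℕ) ≠ b := by omega
      have b1 : (1 : ℕ) ≠ b := by omega
      constructor <;> rw [ext_tw n w _ _ _ (by assumption) (mB b hb) (mB c hc)] <;>
        by_cases hbc : b = c <;> simp [-mul_eq_mul_right_iff, -mul_eq_mul_left_iff, w0, w1, wB c hc2, wB b hb2, c0, c1, b0, b1, hbc] <;> ring
    unfold S3
    simp only [hA]
    rw [Finset.sum_congr rfl fun b hb => Finset.sum_congr rfl fun c hc => (this b hb c hc).1,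
      Finset.sum_congr rfl fun b hb => Finset.sum_congr rfl fun c hc => (this b hb c hc).2]
    have : ∑ b ∈ Finset.Ico 2 (n + 2), ∑ c ∈ Finset.Ico 2 (n + 2),
        (y * t ^ 2 - (if b = c then y * t ^ 2 else 0)) = y * t ^ 2 * ((n : ℝ) ^ 2 - n) := by
      rw [Finset.sum_congr rfl fun b hb => by
        rw [Finset.sum_sub_distrib, Finset.sum_ite_eq, if_pos hb]]
      simp
      ring
    rw [this]
    ring
  have e4 : S3 (tw (extG n) w) (Finset.Ico 2 (n + 2)) (Finset.Ico 2 (n + 2))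
      (Finset.Ico 2 (n + 2)) = 0 := by
    refine S3_zero _ _ _ _ fun a ha b hb c hc => ?_
    rw [ext_tw n w _ _ _ (mB a ha) (mB b hb) (mB c hc), if_neg]
    simp at ha hb hc
    omega
  rw [hv, S3_split _ s1 s2 _ _ hdis, e1, e2, e3, e4]
  ring

theorem ext_lower (n : ℕ) (hn : 0 < n) :
    Real.sqrt 3 / 3 - (3 - Real.sqrt 3) / 3 / n ≤ 6 * (extG n).lag := by
  have hn' : (n : ℝ) ≠ 0 := by positivity
  have h3 : Real.sqrt 3 ^ 2 = 3 := Real.sq_sqrt (by norm_num)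
  have hs0 := Real.sqrt_nonneg 3
  have hs3 : Real.sqrt 3 ≤ 3 := by nlinarith
  have hv := ext_value n ((3 - Real.sqrt 3) / 6) (Real.sqrt 3 / 3 / n)
  have hf : (extG n).IsFeasible (fun v => if v < 2 then (3 - Real.sqrt 3) / 6
      else Real.sqrt 3 / 3 / n) := by
    constructor
    · intro v _
      dsimp only
      split_ifs
      · linarith
      · positivity
    · have hdis : Disjoint ({0, 1} : Finset ℕ) (Finset.Ico 2 (n + 2)) := by
        rw [Finset.disjoint_left]
        intro a ha hb
        simp at ha hb
        omega
      have : (extG n).verts = {0, 1} ∪ Finset.Ico 2 (n + 2) := rfl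
      rw [this, Finset.sum_union hdis, Finset.sum_pair (by decide),
        Finset.sum_congr rfl (g := fun _ => Real.sqrt 3 / 3 / n) fun v hv =>
          if_neg (by simp at hv; omega)]
      simp
      field_simp
      ring
  have := lag_ge _ (extG_free n) _ hf
  have hval : 6 * ((3 - Real.sqrt 3) / 6) ^ 2 * (n * (Real.sqrt 3 / 3 / n)) +
      6 * ((3 - Real.sqrt 3) / 6) * (Real.sqrt 3 / 3 / n) ^ 2 * ((n : ℝ) ^ 2 - n)
      = Real.sqrt 3 / 3 - (3 - Real.sqrt 3) / 3 / n := by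
    have a1 : (n : ℝ) * (Real.sqrt 3 / 3 / n) = Real.sqrt 3 / 3 := by field_simp
    have a2 : (Real.sqrt 3 / 3 / n) ^ 2 * ((n : ℝ) ^ 2 - n) = 1 / 3 * (1 - 1 / n) := by
      rw [div_pow, div_pow, h3]; field_simp
    rw [a1, mul_assoc (6 * ((3 - Real.sqrt 3) / 6)), a2]
    have : ((3 - Real.sqrt 3) / 6) ^ 2 = (2 - Real.sqrt 3) / 6 := by nlinarith
    rw [this]
    field_simp
    nlinarith
  linarith

end partC

/-- The Lagrangian density of `K_4^3 ∪ e` is `√3 / 3`. -/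
theorem lagDensity_K43e : lagDensity K43e = Real.sqrt 3 / 3 := by
  have hub : ∀ x ∈ {x : ℝ | ∃ G : HyperGraph 3, G.Free K43e ∧ x = (Nat.factorial 3 : ℝ) * G.lag},
      x ≤ Real.sqrt 3 / 3 := by
    rintro x ⟨G, hG, rfl⟩
    have := lag_upper G hG
    norm_num [Nat.factorial]
    linarith
  have hs0 := Real.sqrt_nonneg 3
  have h3 : Real.sqrt 3 ^ 2 = 3 := Real.sq_sqrt (by norm_num)
  apply le_antisymm
  · exact Real.sSup_le hub (by positivity)
  · refine le_of_forall_pos_sub_le fun ε hε => ?_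
    obtain ⟨n, hn⟩ := exists_nat_gt (1 / ε)
    have hnpos : (0 : ℝ) < n := lt_trans (by positivity) hn
    have hn0 : 0 < n := by exact_mod_cast hnpos
    have h1 := ext_lower n hn0
    have h2 : (3 - Real.sqrt 3) / 3 / n ≤ ε := by
      rw [div_le_iff₀ hnpos]
      rw [div_lt_iff₀ hε] at hn
      nlinarith
    have h4 : 6 * (extG n).lag ≤ lagDensity K43e := by
      refine le_csSup ⟨_, hub⟩ ⟨extG n, extG_free n, ?_⟩
      norm_num [Nat.factorial]
    linarith
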